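/- arXiv:2409.01654 — 2 statements merged into one kernel-verified Lean document; each statement's English description precedes it below -/
import Mathlib

section
/- Let k ≥ r₁ ≥ r₂ > i ≥ 1 be integers. Then (Φ_{k,r₁,i} / C(k-i, r₁-i))^{1/(r₁-i)} ≤ (Φ_{k,r₂,i} / C(k-i, r₂-i))^{1/(r₂-i)}, where C(a,b) denotes the binomial coefficient. -/
/-- c is a valid uniqueness threshold for the minimum positive i-degree problem:
every n-vertex (n ≥ k) k-partite r-graph without isolated vertices whose minimum positive
i-degree exceeds c·n^{r-i} is uniquely k-colorable. -/
def isUCThreshold (k r i : ℕ) (c : ℝ) : Prop :=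
  ∀ n : ℕ, k ≤ n → ∀ H : Finset (Finset (Fin n)),
    (∀ E ∈ H, E.card = r) →
    (∃ φ : Fin n → Fin k, ∀ E ∈ H, Set.InjOn φ ↑E) →
    (∀ x : Fin n, ∃ E ∈ H, x ∈ E) →
    (∀ e : Finset (Fin n), e.card = i → (∃ E ∈ H, e ⊆ E) →
      c * (n : ℝ) ^ (r - i) <
        (((Finset.univ : Finset (Finset (Fin n))).filter
          (fun f => f.card = r - i ∧ Disjoint e f ∧ e ∪ f ∈ H)).card : ℝ)) →
    ∀ φ θ : Fin n → Fin k, (∀ E ∈ H, Set.InjOn φ ↑E) → (∀ E ∈ H, Set.InjOn θ ↑E) →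
      ∃ η : Equiv.Perm (Fin k), η ∘ φ = θ

/-- Φ_{k,r,i}: the minimum (infimum) threshold. -/
noncomputable def Phi (k r i : ℕ) : ℝ := sInf {c : ℝ | isUCThreshold k r i c}

theorem mul_log_sub_log_le_sub {p q : ℝ} (hp : 0 ≤ p) (hq : 0 ≤ q) (hpq : p ≠ 0 → q ≠ 0) :
    p * (Real.log q - Real.log p) ≤ q - p := by
  rcases hp.eq_or_lt with rfl | hp
  · simpa using hq
  have hq' : 0 < q := lt_of_le_of_ne hq (hpq hp.ne').symm
  rw [← Real.log_div hq'.ne' hp.ne']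
  calc p * Real.log (q / p) ≤ p * (q / p - 1) := by
        gcongr; exact Real.log_le_sub_one_of_pos (by positivity)
    _ = q - p := by field_simp

theorem sum_mul_ite_ne_le {V C : Type*} [Fintype V] [DecidableEq C] (b : V → ℝ) (col : V → C)
    (S : Finset C) {m : ℕ} (hm : 0 < m) (hSm : S.card ≤ m) (hS : ∀ x, b x ≠ 0 → col x ∈ S) :
    ∑ x, ∑ y, (if col x ≠ col y then b x * b y else 0) ≤ (1 - 1 / (m : ℝ)) * (∑ x, b x) ^ 2 := by
  set B : C → ℝ := fun a => ∑ x, if col x = a then b x else 0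
  have hsum : ∑ a ∈ S, B a = ∑ x, b x := by
    rw [Finset.sum_comm]
    refine Finset.sum_congr rfl fun x _ => ?_
    rw [Finset.sum_ite_eq]
    split_ifs with h
    · rfl
    · by_contra h'
      exact h (hS x (Ne.symm h'))
  have hsq : ∑ x, ∑ y, (if col x = col y then b x * b y else 0) = ∑ a ∈ S, B a ^ 2 := by
    have h1 : ∀ a, B a ^ 2
        = ∑ x, ∑ y, if col x = a then if col y = a then b x * b y else 0 else 0 := by
      intro a
      rw [sq, Finset.sum_mul_sum]
      refine Finset.sum_congr rfl fun x _ => Finset.sum_congr rfl fun y _ => ?_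
      split_ifs <;> simp
    rw [Finset.sum_congr rfl fun a _ => h1 a, Finset.sum_comm (s := S)]
    refine Finset.sum_congr rfl fun x _ => ?_
    rw [Finset.sum_comm (s := S)]
    refine Finset.sum_congr rfl fun y _ => ?_
    rw [Finset.sum_ite_eq]
    have hx := hS x
    grind
  have hcs : (∑ x, b x) ^ 2 ≤ m * ∑ a ∈ S, B a ^ 2 := by
    rw [← hsum]
    refine sq_sum_le_card_mul_sum_sq.trans ?_
    gcongr
  have hsplit : ∑ x, ∑ y, (if col x ≠ col y then b x * b y else 0)
      = (∑ x, b x) ^ 2 - ∑ x, ∑ y, (if col x = col y then b x * b y else 0) := by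
    rw [sq, Finset.sum_mul_sum, ← Finset.sum_sub_distrib]
    refine Finset.sum_congr rfl fun x _ => ?_
    rw [← Finset.sum_sub_distrib]
    refine Finset.sum_congr rfl fun y _ => ?_
    split_ifs <;> simp_all
  rw [hsplit, hsq]
  have hm' : (0 : ℝ) < m := by exact_mod_cast hm
  have : (∑ x, b x) ^ 2 / m ≤ ∑ a ∈ S, B a ^ 2 := by
    rw [div_le_iff₀ hm']; linarith
  have e : (1 - 1 / (m : ℝ)) * (∑ x, b x) ^ 2 = (∑ x, b x) ^ 2 - (∑ x, b x) ^ 2 / m := by ring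
  linarith

/-- A symmetric law on pairs of differently coloured points, with `m` colours in use, has mutual
information at least `log (m / (m - 1))` (unnormalised form). -/
theorem two_mul_sum_mul_log_sub_le {V C : Type*} [Fintype V] [DecidableEq C] {c : V → V → ℝ}
    {b : V → ℝ} {T : ℝ} (col : V → C) (S : Finset C) {m : ℕ} (hm : 2 ≤ m) (hSm : S.card ≤ m)
    (hc : ∀ x y, 0 ≤ c x y) (hsymm : ∀ x y, c x y = c y x) (hb : ∀ x, b x = ∑ y, c x y)
    (hT : T = ∑ x, b x) (hcol : ∀ x y, c x y ≠ 0 → col x ≠ col y)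
    (hS : ∀ x, b x ≠ 0 → col x ∈ S) :
    2 * ∑ x, b x * Real.log (b x) - ∑ x, ∑ y, c x y * Real.log (c x y) - T * Real.log T
      ≤ T * Real.log (1 - 1 / (m : ℝ)) := by
  have hb0 : ∀ x, 0 ≤ b x := fun x => hb x ▸ Finset.sum_nonneg fun y _ => hc x y
  have hT0 : 0 ≤ T := hT ▸ Finset.sum_nonneg fun x _ => hb0 x
  have hcb : ∀ x y, c x y ≠ 0 → b x ≠ 0 := by
    intro x y h h'
    rw [hb, Finset.sum_eq_zero_iff_of_nonneg fun y _ => hc x y] at h'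
    exact h (h' y (Finset.mem_univ _))
  have hbT : ∀ x, b x ≠ 0 → T ≠ 0 := by
    intro x h h'
    rw [hT, Finset.sum_eq_zero_iff_of_nonneg fun y _ => hb0 y] at h'
    exact h (h' x (Finset.mem_univ _))
  have hm' : (2 : ℝ) ≤ m := by exact_mod_cast hm
  set ρ : ℝ := 1 - 1 / (m : ℝ) with hρ
  have hρ0 : 0 < ρ := by
    rw [hρ, sub_pos, div_lt_one (by linarith)]; linarith
  have key : ∀ x y, c x y * Real.log (b x) + c x y * Real.log (b y) - c x y * Real.log (c x y)
      - c x y * (Real.log T + Real.log ρ)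
      ≤ (if col x ≠ col y then b x * b y else 0) / (T * ρ) - c x y := by
    intro x y
    by_cases h : c x y = 0
    · simp only [h, zero_mul, sub_zero, add_zero]
      apply div_nonneg _ (by positivity)
      split_ifs
      · exact mul_nonneg (hb0 x) (hb0 y)
      · exact le_rfl
    · have hx := hcb x y h
      have hy := hcb y x (hsymm x y ▸ h)
      have hTne := hbT x hx
      rw [if_pos (hcol x y h)]
      refine le_trans (le_of_eq ?_) (mul_log_sub_log_le_sub (hc x y)
        (div_nonneg (mul_nonneg (hb0 x) (hb0 y)) (by positivity)) fun _ => ?_)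
      · rw [Real.log_div (mul_ne_zero hx hy) (mul_ne_zero hTne hρ0.ne'), Real.log_mul hx hy,
          Real.log_mul hTne hρ0.ne']
        ring
      · exact div_ne_zero (mul_ne_zero hx hy) (mul_ne_zero hTne hρ0.ne')
  have hs1 : ∑ x, ∑ y, c x y * Real.log (b x) = ∑ x, b x * Real.log (b x) :=
    Finset.sum_congr rfl fun x _ => by rw [← Finset.sum_mul, ← hb]
  have hs2 : ∑ x, ∑ y, c x y * Real.log (b y) = ∑ x, b x * Real.log (b x) := by
    rw [Finset.sum_comm, ← hs1]
    exact Finset.sum_congr rfl fun x _ => Finset.sum_congr rfl fun y _ => by rw [hsymm]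
  have hsum := Finset.sum_le_sum fun x (_ : x ∈ Finset.univ) =>
    Finset.sum_le_sum fun y (_ : y ∈ Finset.univ) => key x y
  simp only [Finset.sum_sub_distrib, Finset.sum_add_distrib, ← Finset.sum_mul, ← Finset.sum_div]
    at hsum
  simp only [hs2, ← hb, ← hT] at hsum
  have hR : (∑ x, ∑ y, if col x ≠ col y then b x * b y else 0) / (T * ρ) ≤ T := by
    rcases hT0.eq_or_lt with h | h
    · rw [← h]; simp
    · rw [div_le_iff₀ (by positivity)]
      refine (sum_mul_ite_ne_le b col S (by omega) hSm hS).trans (le_of_eq ?_)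
      rw [← hT]; ring
  linarith

theorem sum_powersetCard_sum_insert {V : Type*} [Fintype V] [DecidableEq V] (g : Finset V → ℝ)
    (j : ℕ) :
    ∑ D ∈ Finset.powersetCard j Finset.univ, ∑ x, (if x ∉ D then g (insert x D) else 0)
      = (j + 1) * ∑ A ∈ Finset.powersetCard (j + 1) Finset.univ, g A := by
  have h : ((j : ℝ) + 1) * ∑ A ∈ Finset.powersetCard (j + 1) Finset.univ, g A
      = ∑ A ∈ Finset.powersetCard (j + 1) Finset.univ, ∑ x : V, if x ∈ A then g A else 0 := by
    rw [Finset.mul_sum]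
    refine Finset.sum_congr rfl fun A hA => ?_
    rw [Finset.sum_ite_mem, Finset.univ_inter, Finset.sum_const, (Finset.mem_powersetCard.1 hA).2]
    simp
  rw [h, Finset.sum_comm, Finset.sum_comm (s := Finset.powersetCard (j + 1) _)]
  refine Finset.sum_congr rfl fun x _ => ?_
  rw [← Finset.sum_filter, ← Finset.sum_filter]
  refine Finset.sum_nbij' (fun D => insert x D) (fun A => A.erase x) ?_ ?_ ?_ ?_ ?_
  · intro D hD
    simp only [Finset.mem_filter, Finset.mem_powersetCard_univ] at hD ⊢
    simp [Finset.card_insert_of_notMem hD.2, hD.1]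
  · intro A hA
    simp only [Finset.mem_filter, Finset.mem_powersetCard_univ] at hA ⊢
    simp [Finset.card_erase_of_mem hA.2, hA.1]
  · intro D hD
    simp only [Finset.mem_filter] at hD
    exact Finset.erase_insert hD.2
  · intro A hA
    simp only [Finset.mem_filter] at hA
    exact Finset.insert_erase hA.2
  · intro D _
    rfl

/-- A concave sequence vanishing at `0` has nonincreasing slopes `g j / j`. -/
theorem mul_le_mul_of_concave {g : ℕ → ℝ} {s t : ℕ} (h0 : g 0 = 0)
    (hg : ∀ j, j + 2 ≤ s → g (j + 2) + g j ≤ 2 * g (j + 1)) (ht : 1 ≤ t) (hts : t ≤ s) :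
    t * g s ≤ s * g t := by
  have step : ∀ j, j + 1 ≤ s → (j : ℝ) * g (j + 1) ≤ (j + 1) * g j := by
    intro j
    induction j with
    | zero => intro _; simp [h0]
    | succ j ih =>
      intro hj
      have h1 := ih (by omega)
      have h2 := hg j (by omega)
      push_cast
      nlinarith [mul_le_mul_of_nonneg_left h2 (by positivity : (0 : ℝ) ≤ j + 1)]
  have main : ∀ u, t ≤ u → u ≤ s → (t : ℝ) * g u ≤ u * g t := by
    intro u hu
    induction u, hu using Nat.le_induction with
    | base => intro _; exact le_rfl
    | succ u hu ih =>
      intro hus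
      have h1 := ih (by omega)
      have h2 := step u hus
      have hu0 : (0 : ℝ) < u := by exact_mod_cast (by omega : 0 < u)
      have ht0 : (0 : ℝ) < t := by exact_mod_cast ht
      push_cast
      have : (u : ℝ) * (t * g (u + 1)) ≤ u * ((u + 1) * g t) := by nlinarith
      exact le_of_mul_le_mul_left this hu0
  exact main s hts le_rfl

/-- The number of edges of `F` containing `A`. -/
def codegree {V : Type*} [DecidableEq V] (F : Finset (Finset V)) (A : Finset V) : ℕ :=
  (F.filter fun E => A ⊆ E).card

/-- The probability that the first `A.card` vertices of a uniformly random ordered edge of the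
`s`-uniform family `F` form a prescribed ordering of `A`. -/
noncomputable def initialProb {V : Type*} [DecidableEq V] (F : Finset (Finset V)) (s : ℕ)
    (A : Finset V) : ℝ :=
  codegree F A * ((s - A.card).factorial / (F.card * s.factorial))

section initialProb

variable {V : Type*} [DecidableEq V] {F : Finset (Finset V)} {s : ℕ}

theorem initialProb_nonneg (A : Finset V) : 0 ≤ initialProb F s A := by
  unfold initialProb; positivity

theorem exists_superset_of_initialProb_ne_zero {A : Finset V} (h : initialProb F s A ≠ 0) :
    ∃ E ∈ F, A ⊆ E := by
  have : codegree F A ≠ 0 := by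
    intro h'
    exact h (by simp [initialProb, h'])
  simpa [codegree, Finset.filter_eq_empty_iff] using this

variable [Fintype V]

theorem sum_codegree_insert (hF : ∀ E ∈ F, E.card = s) (D : Finset V) :
    ∑ x, (if x ∉ D then codegree F (insert x D) else 0) = (s - D.card) * codegree F D := by
  have h : ∀ x, (if x ∉ D then codegree F (insert x D) else 0)
      = ∑ E ∈ F.filter (fun E => D ⊆ E), if x ∈ E \ D then 1 else 0 := by
    intro x
    rw [← Finset.card_filter, Finset.filter_filter, codegree]
    by_cases hx : x ∈ D
    · simp [hx]
    · rw [if_pos hx]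
      congr 1
      ext E
      simp [Finset.insert_subset_iff, hx, and_comm]
  simp_rw [h]
  rw [Finset.sum_comm, codegree, mul_comm, ← smul_eq_mul, ← Finset.sum_const]
  refine Finset.sum_congr rfl fun E hE => ?_
  rw [Finset.mem_filter] at hE
  rw [Finset.sum_ite_mem, Finset.univ_inter, Finset.sum_const, Finset.card_sdiff_of_subset hE.2,
    hF E hE.1]
  simp

theorem initialProb_eq_sum (hF : ∀ E ∈ F, E.card = s) {D : Finset V} (hD : D.card < s) :
    initialProb F s D = ∑ x, if x ∉ D then initialProb F s (insert x D) else 0 := by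
  have h1 : ∀ x, (if x ∉ D then initialProb F s (insert x D) else 0)
      = ((if x ∉ D then codegree F (insert x D) else 0 : ℕ) : ℝ)
        * ((s - (D.card + 1)).factorial / (F.card * s.factorial)) := by
    intro x
    by_cases hx : x ∈ D
    · simp [hx]
    · rw [if_pos hx, if_pos hx, initialProb, Finset.card_insert_of_notMem hx]
  rw [Finset.sum_congr rfl fun x _ => h1 x, ← Finset.sum_mul, ← Nat.cast_sum,
    sum_codegree_insert hF, initialProb]
  obtain ⟨m, hm⟩ : ∃ m, s - D.card = m + 1 := ⟨s - D.card - 1, by omega⟩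
  rw [show s - (D.card + 1) = m by omega, hm, Nat.factorial_succ]
  push_cast
  ring

theorem factorial_mul_sum_initialProb (hF : ∀ E ∈ F, E.card = s) (hne : F.Nonempty) {j : ℕ}
    (hj : j ≤ s) :
    (j.factorial : ℝ) * ∑ A ∈ Finset.powersetCard j Finset.univ, initialProb F s A = 1 := by
  induction j with
  | zero =>
    have : (F.card : ℝ) ≠ 0 := by exact_mod_cast hne.card_pos.ne'
    have : (s.factorial : ℝ) ≠ 0 := by positivity
    simp only [Nat.factorial_zero, Nat.cast_one, Finset.powersetCard_zero, Finset.sum_singleton,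
      initialProb, codegree, Finset.empty_subset, Finset.filter_true, Finset.card_empty, one_mul,
      Nat.sub_zero]
    field_simp
  | succ j ih =>
    rw [← ih (by omega), Nat.factorial_succ, Nat.cast_mul, mul_comm ((j + 1 : ℕ) : ℝ), mul_assoc,
      Nat.cast_succ, ← sum_powersetCard_sum_insert]
    congr 1
    refine Finset.sum_congr rfl fun D hD => ?_
    rw [← initialProb_eq_sum hF (by rw [(Finset.mem_powersetCard.1 hD).2]; omega)]

/-- The entropy of the first `j` vertices of a uniformly random ordered edge. -/
noncomputable def initialEntropy (F : Finset (Finset V)) (s j : ℕ) : ℝ :=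
  -(j.factorial * ∑ A ∈ Finset.powersetCard j Finset.univ,
    initialProb F s A * Real.log (initialProb F s A))

theorem initialEntropy_zero (hne : F.Nonempty) : initialEntropy F s 0 = 0 := by
  have : (F.card : ℝ) ≠ 0 := by exact_mod_cast hne.card_pos.ne'
  have : (s.factorial : ℝ) ≠ 0 := by positivity
  have h : initialProb F s ∅ = 1 := by
    simp only [initialProb, codegree, Finset.empty_subset, Finset.filter_true, Finset.card_empty,
      Nat.sub_zero]
    field_simp
  simp [initialEntropy, h]

theorem initialEntropy_self (hF : ∀ E ∈ F, E.card = s) (hne : F.Nonempty) :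
    initialEntropy F s s = Real.log (F.card * s.factorial) := by
  have h : ∀ A ∈ Finset.powersetCard s Finset.univ,
      initialProb F s A * Real.log (initialProb F s A)
        = initialProb F s A * -Real.log (F.card * s.factorial) := by
    intro A hA
    by_cases hp : initialProb F s A = 0
    · simp [hp]
    congr 1
    have hA' := (Finset.mem_powersetCard.1 hA).2
    obtain ⟨E, hE, hAE⟩ := exists_superset_of_initialProb_ne_zero hp
    obtain rfl : A = E := Finset.eq_of_subset_of_card_le hAE (by rw [hF E hE, hA'])
    have hc : codegree F A = 1 := by
      rw [codegree, Finset.card_eq_one]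
      refine ⟨A, ?_⟩
      ext E
      simp only [Finset.mem_filter, Finset.mem_singleton]
      constructor
      · rintro ⟨h1, h2⟩
        exact (Finset.eq_of_subset_of_card_le h2 (by rw [hF E h1, hA'])).symm
      · rintro rfl
        exact ⟨hE, subset_rfl⟩
    rw [initialProb, hc, hA', Nat.sub_self, ← Real.log_inv]
    simp
  rw [initialEntropy, Finset.sum_congr rfl h, ← Finset.sum_mul, ← mul_assoc,
    factorial_mul_sum_initialProb hF hne le_rfl]
  ring

theorem initialEntropy_le (hF : ∀ E ∈ F, E.card = s) (hne : F.Nonempty) {j : ℕ} (hj : j ≤ s)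
    {M : Finset (Finset V)} (hM : ∀ E ∈ F, ∀ A ⊆ E, A.card = j → A ∈ M) :
    initialEntropy F s j ≤ Real.log (M.card * j.factorial) := by
  have hfac : (0 : ℝ) < j.factorial := by positivity
  have hMne : M.Nonempty := by
    obtain ⟨E, hE⟩ := hne
    obtain ⟨A, hA, hAj⟩ := Finset.exists_subset_card_eq (hj.trans_eq (hF E hE).symm)
    exact ⟨A, hM E hE A hA hAj⟩
  have hMpos : (0 : ℝ) < M.card := by exact_mod_cast hMne.card_pos
  set q : ℝ := (M.card * j.factorial)⁻¹ with hq
  have hq0 : 0 < q := by positivity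
  have key : ∀ A ∈ Finset.powersetCard j Finset.univ,
      initialProb F s A * Real.log q - initialProb F s A * Real.log (initialProb F s A)
        ≤ (if A ∈ M then q else 0) - initialProb F s A := by
    intro A hA
    by_cases hp : initialProb F s A = 0
    · simp only [hp, zero_mul, sub_zero]
      split_ifs <;> positivity
    · obtain ⟨E, hE, hAE⟩ := exists_superset_of_initialProb_ne_zero hp
      rw [if_pos (hM E hE A hAE (Finset.mem_powersetCard.1 hA).2), ← mul_sub]
      exact mul_log_sub_log_le_sub (initialProb_nonneg A) hq0.le fun _ => hq0.ne'
  have hsum := Finset.sum_le_sum key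
  rw [Finset.sum_sub_distrib, Finset.sum_sub_distrib, ← Finset.sum_mul] at hsum
  have hcard : ∑ A ∈ Finset.powersetCard j Finset.univ, (if A ∈ M then q else 0)
      ≤ M.card * q := by
    rw [← Finset.sum_filter, Finset.sum_const, nsmul_eq_mul]
    gcongr
    intro A hA
    exact (Finset.mem_filter.1 hA).2
  have hMq : (j.factorial : ℝ) * (M.card * q) = 1 := by
    rw [hq]; field_simp
  have h1 := factorial_mul_sum_initialProb hF hne hj
  have hlog : Real.log q = -Real.log (M.card * j.factorial) := by rw [hq, Real.log_inv]
  have h2 := mul_le_mul_of_nonneg_left (hsum.trans (sub_le_sub_right hcard _)) hfac.le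
  rw [mul_sub, mul_sub, hMq, h1, ← mul_assoc, h1, hlog] at h2
  rw [initialEntropy]
  linarith

theorem initialEntropy_concave {C : Type*} [DecidableEq C] {φ : V → C} {K : Finset C}
    (hF : ∀ E ∈ F, E.card = s) (hne : F.Nonempty) (hφ : ∀ E ∈ F, Set.InjOn φ E)
    (hK : ∀ E ∈ F, ∀ x ∈ E, φ x ∈ K) {j : ℕ} (hj : j + 2 ≤ s) (hs : s ≤ K.card) :
    initialEntropy F s (j + 2) + initialEntropy F s j
      ≤ 2 * initialEntropy F s (j + 1) + Real.log (1 - 1 / ((K.card - j : ℕ) : ℝ)) := by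
  set p := initialProb F s with hp
  set L : Finset V → ℝ := fun A => p A * Real.log (p A) with hL
  set G : Finset V → ℝ := fun A => ∑ y, if y ∉ A then L (insert y A) else 0 with hG
  have key : ∀ D ∈ Finset.powersetCard j Finset.univ,
      2 * ∑ x, (if x ∉ D then L (insert x D) else 0)
        - ∑ x, (if x ∉ D then G (insert x D) else 0) - L D
        ≤ p D * Real.log (1 - 1 / ((K.card - j : ℕ) : ℝ)) := by
    intro D hD
    have hDj := (Finset.mem_powersetCard.1 hD).2
    set c : V → V → ℝ := fun x y =>
      if x ∉ D then if y ∉ insert x D then p (insert y (insert x D)) else 0 else 0 with hc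
    set b : V → ℝ := fun x => if x ∉ D then p (insert x D) else 0 with hb
    have hc0 : ∀ x y, c x y ≠ 0 → x ∉ D ∧ y ∉ insert x D ∧ ∃ E ∈ F, insert y (insert x D) ⊆ E := by
      intro x y h
      simp only [hc, ne_eq, ite_eq_right_iff, Classical.not_imp] at h
      exact ⟨h.1, h.2.1, exists_superset_of_initialProb_ne_zero h.2.2⟩
    have hb0 : ∀ x, b x ≠ 0 → x ∉ D ∧ ∃ E ∈ F, insert x D ⊆ E := by
      intro x h
      simp only [hb, ne_eq, ite_eq_right_iff, Classical.not_imp] at h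
      exact ⟨h.1, exists_superset_of_initialProb_ne_zero h.2⟩
    obtain ⟨S, hS, hSb⟩ : ∃ S : Finset C, S.card ≤ K.card - j ∧ ∀ x, b x ≠ 0 → φ x ∈ S := by
      by_cases h : ∃ E ∈ F, D ⊆ E
      · obtain ⟨E, hE, hDE⟩ := h
        refine ⟨K \ D.image φ, ?_, fun x hx => ?_⟩
        · rw [Finset.card_sdiff_of_subset, Finset.card_image_of_injOn, hDj]
          · exact (hφ E hE).mono (by exact_mod_cast hDE)
          · exact Finset.image_subset_iff.2 fun x hx => hK E hE x (hDE hx)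
        · obtain ⟨hxD, E', hE', hxE'⟩ := hb0 x hx
          rw [Finset.insert_subset_iff] at hxE'
          simp only [Finset.mem_sdiff, Finset.mem_image, not_exists, not_and]
          refine ⟨hK E' hE' x hxE'.1, fun y hy hyx => hxD ?_⟩
          rwa [← hφ E' hE' (hxE'.2 hy) hxE'.1 hyx]
      · refine ⟨∅, by simp, fun x hx => absurd ?_ h⟩
        obtain ⟨-, E', hE', hxE'⟩ := hb0 x hx
        exact ⟨E', hE', (Finset.subset_insert _ _).trans hxE'⟩
    have main := two_mul_sum_mul_log_sub_le (c := c) (b := b) (T := p D) φ S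
      (m := K.card - j) (by omega) hS ?_ ?_ ?_ ?_ ?_ hSb
    · convert main using 3
      · congr 1
        refine Finset.sum_congr rfl fun x _ => ?_
        simp only [hb]
        by_cases hx : x ∈ D <;> simp [hx, hL]
      · refine Finset.sum_congr rfl fun x _ => ?_
        by_cases hx : x ∈ D
        · simp [hc, hx]
        · simp only [hc, hG, hx, not_false_eq_true, if_true]
          refine Finset.sum_congr rfl fun y _ => ?_
          by_cases hy : y ∈ insert x D <;> simp only [hy, hL, not_true_eq_false,
            not_false_eq_true, if_true, if_false, zero_mul]
    · intro x y
      simp only [hc]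
      refine ite_nonneg (ite_nonneg (initialProb_nonneg _) le_rfl) le_rfl
    · intro x y
      simp only [hc, Finset.mem_insert, not_or, Finset.insert_comm y x D]
      by_cases hx : x ∈ D <;> by_cases hy : y ∈ D <;> simp [hx, hy, eq_comm]
    · intro x
      by_cases hx : x ∈ D
      · simp [hb, hc, hx]
      · simp only [hb, hc, hx, not_false_eq_true, if_true]
        rw [hp, initialProb_eq_sum hF]
        rw [Finset.card_insert_of_notMem hx]; omega
    · rw [hp, initialProb_eq_sum hF (by omega)]
    · intro x y h
      obtain ⟨hx, hy, E, hE, hsub⟩ := hc0 x y h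
      rw [Finset.insert_subset_iff, Finset.insert_subset_iff] at hsub
      intro he
      exact hy (by simp [hφ E hE hsub.2.1 hsub.1 he])
  have hsum := Finset.sum_le_sum key
  rw [Finset.sum_sub_distrib, Finset.sum_sub_distrib, ← Finset.mul_sum, ← Finset.sum_mul,
    sum_powersetCard_sum_insert, sum_powersetCard_sum_insert, sum_powersetCard_sum_insert] at hsum
  have h1 := factorial_mul_sum_initialProb hF hne (j := j) (by omega)
  have h2 := mul_le_mul_of_nonneg_left hsum (by positivity : (0 : ℝ) ≤ j.factorial)
  rw [← mul_assoc (j.factorial : ℝ) (∑ A ∈ _, p A), h1, one_mul] at h2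
  simp only [initialEntropy, Nat.factorial_succ]
  push_cast at h2 ⊢
  simp only [hL, hp] at h2
  linarith

end initialProb

theorem log_one_sub_one_div {m : ℕ} (hm : 2 ≤ m) :
    Real.log (1 - 1 / (m : ℝ)) = Real.log ((m - 1 : ℕ) : ℝ) - Real.log m := by
  have h2 : (2 : ℝ) ≤ m := by exact_mod_cast hm
  rw [← Real.log_div, Nat.cast_sub (by omega)]
  · congr 1; field_simp; simp
  · rw [Nat.cast_ne_zero]; omega
  · rw [Nat.cast_ne_zero]; omega

/-- Power form of the Frankl–Füredi–Kalai theorem: an `s`-uniform family whose edges are rainbow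
for a colouring with palette `K` has a large `t`-th shadow. -/
theorem card_div_choose_pow_le_of_rainbow {V C : Type*} [Fintype V] [DecidableEq V] [DecidableEq C]
    {F M : Finset (Finset V)} {φ : V → C} {K : Finset C} {s t : ℕ} (ht : 1 ≤ t) (hts : t ≤ s)
    (hs : s ≤ K.card) (hF : ∀ E ∈ F, E.card = s) (hφ : ∀ E ∈ F, Set.InjOn φ E)
    (hK : ∀ E ∈ F, ∀ x ∈ E, φ x ∈ K) (hM : ∀ E ∈ F, ∀ A ⊆ E, A.card = t → A ∈ M) :
    ((F.card : ℝ) / K.card.choose s) ^ t ≤ ((M.card : ℝ) / K.card.choose t) ^ s := by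
  rcases F.eq_empty_or_nonempty with rfl | hne
  · rw [Finset.card_empty, Nat.cast_zero, zero_div, zero_pow (by omega)]
    positivity
  set d := K.card
  set g : ℕ → ℝ := fun j => initialEntropy F s j - Real.log (d.descFactorial j)
  have hdesc : ∀ j, j ≤ d → (d.descFactorial j : ℝ) ≠ 0 := fun j hj => by
    rw [Nat.cast_ne_zero, Ne, Nat.descFactorial_eq_zero_iff_lt]; omega
  have hg : (t : ℝ) * g s ≤ s * g t := by
    refine mul_le_mul_of_concave (by simp [g, initialEntropy_zero hne]) (fun j hj => ?_) ht hts
    have h := initialEntropy_concave hF hne hφ hK hj hs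
    rw [log_one_sub_one_div (by omega)] at h
    simp only [g]
    have e1 : Real.log (d.descFactorial (j + 1))
        = Real.log ((d - j : ℕ) : ℝ) + Real.log (d.descFactorial j) := by
      rw [Nat.descFactorial_succ, Nat.cast_mul, Real.log_mul _ (hdesc _ (by omega))]
      rw [Nat.cast_ne_zero]; omega
    have e2 : Real.log (d.descFactorial (j + 2))
        = Real.log ((d - j - 1 : ℕ) : ℝ) + Real.log (d.descFactorial (j + 1)) := by
      rw [Nat.descFactorial_succ d (j + 1), Nat.cast_mul, Real.log_mul _ (hdesc _ (by omega)),
        Nat.sub_sub]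
      rw [Nat.cast_ne_zero]; omega
    linarith
  have hdiv : ∀ N j : ℕ, j ≤ d → 0 < N →
      Real.log (N * j.factorial) - Real.log (d.descFactorial j)
        = Real.log ((N : ℝ) / d.choose j) := by
    intro N j hj hN
    rw [← Real.log_div (by positivity) (hdesc j hj), Nat.descFactorial_eq_factorial_mul_choose,
      Nat.cast_mul, mul_comm (j.factorial : ℝ), mul_div_mul_right _ _ (by positivity)]
  have hMpos : 0 < M.card := by
    obtain ⟨E, hE⟩ := hne
    obtain ⟨A, hA, hAt⟩ := Finset.exists_subset_card_eq (hts.trans_eq (hF E hE).symm)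
    exact Finset.card_pos.2 ⟨A, hM E hE A hA hAt⟩
  have hFpos := hne.card_pos
  have hcs : 0 < d.choose s := Nat.choose_pos hs
  have hct : 0 < d.choose t := Nat.choose_pos (hts.trans hs)
  have h1 : g s = Real.log ((F.card : ℝ) / d.choose s) := by
    rw [← hdiv _ _ hs hFpos, ← initialEntropy_self hF hne]
  have h2 : g t ≤ Real.log ((M.card : ℝ) / d.choose t) := by
    rw [← hdiv _ _ (hts.trans hs) hMpos]
    exact sub_le_sub_right (initialEntropy_le hF hne hts hM) _
  rw [← Real.log_le_log_iff (by positivity) (by positivity), Real.log_pow, Real.log_pow, ← h1]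
  exact hg.trans (mul_le_mul_of_nonneg_left h2 (by positivity))

theorem nonneg_of_isUCThreshold {k r i : ℕ} {c : ℝ} (hr : 2 ≤ r) (hk : r ≤ k)
    (hc : isUCThreshold k r i c) : 0 ≤ c := by
  by_contra! hneg
  set a : Fin k := ⟨0, by omega⟩ with ha
  set b : Fin k := ⟨1, by omega⟩ with hb
  set e : Fin (k + k) ≃ Fin k ⊕ Fin k := finSumFinEquiv.symm
  set φ : Fin (k + k) → Fin k := fun x => Sum.elim id id (e x)
  set θ : Fin (k + k) → Fin k := fun x => Sum.elim id (Equiv.swap a b) (e x)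
  have hcover : ∀ x, ∃ W : Finset (Fin (k + k)), x ∈ W ∧ W.card = k ∧ Set.InjOn φ W ∧
      Set.InjOn θ W := by
    intro x
    obtain ⟨z, rfl⟩ := e.symm.surjective x
    rcases z with z | z
    · refine ⟨Finset.univ.image fun y => e.symm (Sum.inl y), by simp, ?_, ?_, ?_⟩
      · rw [Finset.card_image_of_injective _ fun y z h => Sum.inl_injective (e.symm.injective h)]
        simp
      · simp [Set.InjOn, φ]
      · simp [Set.InjOn, θ]
    · refine ⟨Finset.univ.image fun y => e.symm (Sum.inr y), by simp, ?_, ?_, ?_⟩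
      · rw [Finset.card_image_of_injective _ fun y z h => Sum.inr_injective (e.symm.injective h)]
        simp
      · simp [Set.InjOn, φ]
      · simp [Set.InjOn, θ]
  classical
  set H : Finset (Finset (Fin (k + k))) := Finset.univ.filter fun E =>
    E.card = r ∧ Set.InjOn φ E ∧ Set.InjOn θ E with hH
  have hmem : ∀ E, E ∈ H ↔ E.card = r ∧ Set.InjOn φ E ∧ Set.InjOn θ E := by simp [hH]
  have hpos : (0 : ℝ) < ((k + k : ℕ) : ℝ) ^ (r - i) := by
    have : 0 < k + k := by omega
    positivity
  obtain ⟨η, hη⟩ := hc (k + k) (by omega) H (fun E hE => ((hmem E).1 hE).1)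
    ⟨φ, fun E hE => ((hmem E).1 hE).2.1⟩
    (fun x => by
      obtain ⟨W, hxW, hW, h1, h2⟩ := hcover x
      obtain ⟨E, hxE, hEW, hE⟩ := Finset.exists_subsuperset_card_eq
        (Finset.singleton_subset_iff.2 hxW) (n := r) (by simp; omega) (by omega)
      exact ⟨E, (hmem E).2 ⟨hE, h1.mono (by exact_mod_cast hEW), h2.mono (by exact_mod_cast hEW)⟩,
        Finset.singleton_subset_iff.1 hxE⟩)
    (fun _ _ _ => (mul_neg_of_neg_of_pos hneg hpos).trans_le (Nat.cast_nonneg _))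
    φ θ (fun E hE => ((hmem E).1 hE).2.1) (fun E hE => ((hmem E).1 hE).2.2)
  have h1 := congrFun hη (e.symm (Sum.inl a))
  have h2 := congrFun hη (e.symm (Sum.inr a))
  simp only [Function.comp_apply, φ, θ, Equiv.apply_symm_apply, Sum.elim_inl, Sum.elim_inr, id_eq,
    Equiv.swap_apply_left] at h1 h2
  rw [h1] at h2
  simp [ha, hb] at h2

theorem isUCThreshold_one {k r i : ℕ} (hir : i ≤ r) (hk : 1 ≤ k) : isUCThreshold k r i 1 := by
  intro n hn H hHr _ hiso hdeg
  exfalso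
  obtain ⟨E, hE, -⟩ := hiso ⟨0, by omega⟩
  obtain ⟨e, heE, hei⟩ := Finset.exists_subset_card_eq (hir.trans_eq (hHr E hE).symm)
  have h := hdeg e hei ⟨E, hE, heE⟩
  have hle : ((Finset.univ : Finset (Finset (Fin n))).filter
      (fun f => f.card = r - i ∧ Disjoint e f ∧ e ∪ f ∈ H)).card ≤ n ^ (r - i) := by
    refine le_trans (Finset.card_le_card (t := Finset.powersetCard (r - i) Finset.univ) ?_) ?_
    · intro f hf
      simp only [Finset.mem_filter] at hf
      simpa using hf.2.1
    · rw [Finset.card_powersetCard, Finset.card_univ, Fintype.card_fin]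
      exact Nat.choose_le_pow _ _
  rw [one_mul] at h
  exact absurd (by exact_mod_cast h) hle.not_gt

/-- Passing to the `r₂`-shadow turns a threshold for `r₂`-graphs into one for `r₁`-graphs. -/
theorem isUCThreshold_of_shadow {k r₁ r₂ i : ℕ} (hi : 1 ≤ i) (hir : i < r₂) (hr : r₂ ≤ r₁)
    (hk : r₁ ≤ k) {u : ℝ} (hu : 0 ≤ u)
    (h : isUCThreshold k r₂ i ((k - i).choose (r₂ - i) * u ^ (r₂ - i))) :
    isUCThreshold k r₁ i ((k - i).choose (r₁ - i) * u ^ (r₁ - i)) := by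
  classical
  intro n hn H hHr hpart hiso hdeg φ θ hφ hθ
  set S : Finset (Finset (Fin n)) :=
    Finset.univ.filter fun A => A.card = r₂ ∧ ∃ E ∈ H, A ⊆ E with hS
  have hmem : ∀ A, A ∈ S ↔ A.card = r₂ ∧ ∃ E ∈ H, A ⊆ E := by simp [hS]
  have hinj : ∀ ψ : Fin n → Fin k, (∀ E ∈ H, Set.InjOn ψ E) → ∀ A ∈ S, Set.InjOn ψ A := by
    intro ψ hψ A hA
    obtain ⟨-, E, hE, hAE⟩ := (hmem A).1 hA
    exact (hψ E hE).mono (by exact_mod_cast hAE)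
  refine h n hn S (fun A hA => ((hmem A).1 hA).1) ⟨φ, hinj φ hφ⟩ ?_ ?_ φ θ (hinj φ hφ) (hinj θ hθ)
  · intro x
    obtain ⟨E, hE, hxE⟩ := hiso x
    obtain ⟨A, hxA, hAE, hA⟩ := Finset.exists_subsuperset_card_eq
      (Finset.singleton_subset_iff.2 hxE) (n := r₂) (by simp; omega) (by rw [hHr E hE]; exact hr)
    exact ⟨A, (hmem A).2 ⟨hA, E, hE, hAE⟩, Finset.singleton_subset_iff.1 hxA⟩
  intro e hei ⟨A, hA, heA⟩
  obtain ⟨-, E₀, hE₀, hAE₀⟩ := (hmem A).1 hA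
  have heE₀ := heA.trans hAE₀
  have hd := hdeg e hei ⟨E₀, hE₀, heE₀⟩
  set F : Finset (Finset (Fin n)) := Finset.univ.filter
    fun f => f.card = r₁ - i ∧ Disjoint e f ∧ e ∪ f ∈ H with hF
  set M : Finset (Finset (Fin n)) := Finset.univ.filter
    fun f => f.card = r₂ - i ∧ Disjoint e f ∧ e ∪ f ∈ S with hM
  have hmemF : ∀ f, f ∈ F ↔ f.card = r₁ - i ∧ Disjoint e f ∧ e ∪ f ∈ H := by simp [hF]
  have hmemM : ∀ f, f ∈ M ↔ f.card = r₂ - i ∧ Disjoint e f ∧ e ∪ f ∈ S := by simp [hM]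
  set K : Finset (Fin k) := Finset.univ \ e.image φ with hKdef
  have hKcard : K.card = k - i := by
    rw [hKdef, Finset.card_sdiff_of_subset (Finset.subset_univ _), Finset.card_image_of_injOn, hei,
      Finset.card_univ, Fintype.card_fin]
    exact (hφ E₀ hE₀).mono (by exact_mod_cast heE₀)
  have hKK := card_div_choose_pow_le_of_rainbow (F := F) (M := M) (φ := φ) (K := K)
    (s := r₁ - i) (t := r₂ - i) (by omega) (by omega) (by omega) (fun f hf => ((hmemF f).1 hf).1)
    (fun f hf => (hφ _ ((hmemF f).1 hf).2.2).mono (by simp))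
    (fun f hf x hx => by
      obtain ⟨-, hdisj, hef⟩ := (hmemF f).1 hf
      simp only [hKdef, Finset.mem_sdiff, Finset.mem_univ, true_and, Finset.mem_image, not_exists,
        not_and]
      intro y hy hyx
      have := hφ _ hef (by simp [hy]) (by simp [hx]) hyx
      subst this
      exact Finset.disjoint_left.1 hdisj hy hx)
    (fun f hf g hg hgc => by
      obtain ⟨-, hdisj, hef⟩ := (hmemF f).1 hf
      have hd' : Disjoint e g := hdisj.mono_right hg
      refine (hmemM g).2 ⟨hgc, hd', (hmem _).2 ⟨?_, e ∪ f, hef, Finset.union_subset_union_right hg⟩⟩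
      rw [Finset.card_union_of_disjoint hd', hei, hgc]
      omega)
  rw [hKcard] at hKK
  have hC₁ : (0 : ℝ) < (k - i).choose (r₁ - i) := by
    exact_mod_cast Nat.choose_pos (by omega)
  have hC₂ : (0 : ℝ) < (k - i).choose (r₂ - i) := by
    exact_mod_cast Nat.choose_pos (by omega)
  by_contra! hcon
  have h1 : (u * n) ^ (r₁ - i) < (F.card : ℝ) / (k - i).choose (r₁ - i) := by
    rw [lt_div_iff₀ hC₁, mul_pow]
    linarith
  have h2 : (M.card : ℝ) / (k - i).choose (r₂ - i) ≤ (u * n) ^ (r₂ - i) := by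
    rw [div_le_iff₀ hC₂, mul_pow]
    linarith
  have h3 := pow_lt_pow_left₀ h1 (by positivity) (n := r₂ - i) (by omega)
  have h4 := pow_le_pow_left₀ (by positivity) h2 (r₁ - i)
  rw [pow_right_comm] at h3
  linarith

/-- Monotonicity: for k ≥ r₁ ≥ r₂ > i ≥ 1,
(Φ_{k,r₁,i}/C(k-i,r₁-i))^{1/(r₁-i)} ≤ (Φ_{k,r₂,i}/C(k-i,r₂-i))^{1/(r₂-i)}. -/
theorem stmt11 (k r₁ r₂ i : ℕ) (hi : 1 ≤ i) (hir : i < r₂) (hr : r₂ ≤ r₁) (hk : r₁ ≤ k) :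
    (Phi k r₁ i / ((k - i).choose (r₁ - i) : ℝ)) ^ ((1 : ℝ) / ((r₁ - i : ℕ) : ℝ)) ≤
    (Phi k r₂ i / ((k - i).choose (r₂ - i) : ℝ)) ^ ((1 : ℝ) / ((r₂ - i : ℕ) : ℝ)) := by
  have hC₁ : (0 : ℝ) < (k - i).choose (r₁ - i) := by
    exact_mod_cast Nat.choose_pos (by omega)
  have hC₂ : (0 : ℝ) < (k - i).choose (r₂ - i) := by
    exact_mod_cast Nat.choose_pos (by omega)
  have hΦ₁ : 0 ≤ Phi k r₁ i :=
    Real.sInf_nonneg fun c hc => nonneg_of_isUCThreshold (by omega) hk hc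
  have hs : r₁ - i ≠ 0 := by omega
  have ht : r₂ - i ≠ 0 := by omega
  have hΦ₂ : 0 ≤ Phi k r₂ i :=
    Real.sInf_nonneg fun c hc => nonneg_of_isUCThreshold (by omega) (hr.trans hk) hc
  set v := (Phi k r₁ i / ((k - i).choose (r₁ - i) : ℝ)) ^ ((1 : ℝ) / ((r₁ - i : ℕ) : ℝ)) with hv
  have hv0 : 0 ≤ v := by positivity
  have key : (k - i).choose (r₂ - i) * v ^ (r₂ - i) ≤ Phi k r₂ i := by
    refine le_csInf ⟨1, isUCThreshold_one hir.le (by omega)⟩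
      fun c (hc : isUCThreshold k r₂ i c) => ?_
    have hc0 : 0 ≤ c := nonneg_of_isUCThreshold (by omega) (hr.trans hk) hc
    set u := (c / ((k - i).choose (r₂ - i) : ℝ)) ^ ((1 : ℝ) / ((r₂ - i : ℕ) : ℝ)) with hu
    have hu0 : 0 ≤ u := by positivity
    have huc : (k - i).choose (r₂ - i) * u ^ (r₂ - i) = c := by
      rw [hu, one_div, Real.rpow_inv_natCast_pow (by positivity) ht]
      field_simp
    have hle : Phi k r₁ i ≤ (k - i).choose (r₁ - i) * u ^ (r₁ - i) :=
      csInf_le ⟨0, fun c hc => nonneg_of_isUCThreshold (by omega) hk hc⟩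
        (isUCThreshold_of_shadow hi hir hr hk hu0 (huc ▸ hc))
    have hvu : v ≤ u := by
      rw [hv, one_div, Real.rpow_inv_le_iff_of_pos (by positivity) hu0 (by positivity),
        Real.rpow_natCast, div_le_iff₀ hC₁]
      linarith
    rw [← huc]
    gcongr
  rw [one_div, Real.le_rpow_inv_iff_of_pos hv0 (by positivity) (by positivity), Real.rpow_natCast,
    le_div_iff₀ hC₂]
  linarith
end

section
/- Let k ≥ r > i ≥ 1 be integers with k ≤ (4i+2)/3. Then Φ_{k,r,i} = C(k-i, r-i) · (1/(k+2))^{r-i}. -/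
namespace UniqueColoring

open Finset

variable {α γ : Type*}

/-- The colourings `φ` and `θ` agree on whether `u` and `v` have equal colours. -/
def Compat (φ θ : α → γ) (u v : α) : Prop := φ u = φ v ↔ θ u = θ v

/-- `φ` and `θ` induce the same partition of `S`. -/
def NoConf (φ θ : α → γ) (S : Finset α) : Prop := ∀ u ∈ S, ∀ v ∈ S, Compat φ θ u v

variable {φ θ : α → γ} {u v : α}

theorem Compat.comm (h : Compat φ θ u v) : Compat φ θ v u := by
  unfold Compat at *; rw [eq_comm, h, eq_comm]

theorem Compat.swap (h : Compat φ θ u v) : Compat θ φ u v := Iff.symm h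

theorem NoConf.swap {S : Finset α} (h : NoConf φ θ S) : NoConf θ φ S :=
  fun a ha b hb => (h a ha b hb).swap

variable [Fintype α] [DecidableEq α] [DecidableEq γ]

/-- The vertices extending the set `e` to a larger member of the family `Δ`. In particular
`nb Δ ∅` is the vertex set of `Δ` and `nb Δ {x}` is the neighbourhood of `x` in the shadow graph. -/
def nb (Δ : Finset (Finset α)) (e : Finset α) : Finset α :=
  univ.filter fun v => v ∉ e ∧ insert v e ∈ Δ

/-- The link of the vertex `x`. -/
def lk (Δ : Finset (Finset α)) (x : α) : Finset (Finset α) :=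
  univ.filter fun e => x ∉ e ∧ insert x e ∈ Δ

/-- `Δ` is a nonempty simplicial complex all of whose faces of size less than `i` extend,
and all of whose faces of size `i` have more than `D` extensions. -/
structure IsCx (Δ : Finset (Finset α)) (i : ℕ) (D : ℝ) : Prop where
  down : ∀ e ∈ Δ, ∀ f ⊆ e, f ∈ Δ
  empty : ∅ ∈ Δ
  ext : ∀ e ∈ Δ, #e < i → (nb Δ e).Nonempty
  deg : ∀ e ∈ Δ, #e = i → D < #(nb Δ e)
  nonneg : 0 ≤ D

/-- `φ` is a strong colouring of `Δ` using at most `k` colours. -/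
structure Colored (Δ : Finset (Finset α)) (k : ℕ) (φ : α → γ) : Prop where
  inj : ∀ e ∈ Δ, Set.InjOn φ (e : Set α)
  card : #((nb Δ ∅).image φ) ≤ k

variable {Δ : Finset (Finset α)} {i k : ℕ} {D : ℝ} {e f : Finset α} {x : α}

theorem mem_nb : v ∈ nb Δ e ↔ v ∉ e ∧ insert v e ∈ Δ := by simp [nb]

theorem mem_vert : v ∈ nb Δ ∅ ↔ {v} ∈ Δ := by simp [nb]

theorem mem_nb_comm : v ∈ nb Δ {u} ↔ u ∈ nb Δ {v} := by
  simp only [mem_nb, mem_singleton, Finset.pair_comm v u, eq_comm]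

theorem nb_lk (hx : x ∉ e) : nb (lk Δ x) e = nb Δ (insert x e) := by
  ext v
  simp only [nb, lk, mem_filter, mem_univ, true_and, mem_insert, not_or, Finset.insert_comm v x]
  constructor
  · rintro ⟨h1, ⟨h2, _⟩, h3⟩; exact ⟨⟨fun h => h2 h.symm, h1⟩, h3⟩
  · rintro ⟨⟨h1, h2⟩, h3⟩; exact ⟨h2, ⟨fun h => h1 h.symm, hx⟩, h3⟩

theorem vert_lk : nb (lk Δ x) ∅ = nb Δ {x} := nb_lk (by simp)

theorem IsCx.nb_anti (h : IsCx Δ i D) (hfe : f ⊆ e) : nb Δ e ⊆ nb Δ f := by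
  intro v hv
  rw [mem_nb] at *
  exact ⟨fun h' => hv.1 (hfe h'), h.down _ hv.2 _ (insert_subset_insert _ hfe)⟩

theorem IsCx.sub_vert (h : IsCx Δ i D) : nb Δ e ⊆ nb Δ ∅ := h.nb_anti (empty_subset _)

theorem IsCx.mem_vert_of_mem (h : IsCx Δ i D) (he : e ∈ Δ) (hv : v ∈ e) : v ∈ nb Δ ∅ :=
  mem_vert.2 (h.down _ he _ (by simpa using hv))

theorem IsCx.adj (h : IsCx Δ i D) (he : e ∈ Δ) (hu : u ∈ e) (hv : v ∈ e) (huv : v ≠ u) :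
    v ∈ nb Δ {u} :=
  mem_nb.2 ⟨by simpa using huv, h.down _ he _ (by simp [insert_subset_iff, hu, hv])⟩

theorem IsCx.adj_nb (h : IsCx Δ i D) (hu : u ∈ e) (hv : v ∈ nb Δ e) : v ∈ nb Δ {u} :=
  h.nb_anti (by simpa using hu) hv

theorem IsCx.exists_ext (h : IsCx Δ i D) (he : e ∈ Δ) {j : ℕ} (hej : #e ≤ j) (hj : j ≤ i + 1) :
    ∃ E ∈ Δ, e ⊆ E ∧ #E = j := by
  induction j, hej using Nat.le_induction with
  | base => exact ⟨e, he, Subset.rfl, rfl⟩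
  | succ j hej ih =>
    obtain ⟨E, hE, heE, hc⟩ := ih (by omega)
    have : (nb Δ E).Nonempty := by
      rcases Nat.lt_or_ge j i with hj' | hj'
      · exact h.ext E hE (by omega)
      · have := h.deg E hE (by omega)
        have h0 := h.nonneg
        rw [← card_pos]
        exact_mod_cast h0.trans_lt this
    obtain ⟨v, hv⟩ := this
    rw [mem_nb] at hv
    exact ⟨_, hv.2, heE.trans (subset_insert _ _), by rw [card_insert_of_notMem hv.1, hc]⟩

theorem Colored.ne (hφ : Colored Δ k φ) (hu : u ∈ e) (hv : v ∈ nb Δ e) : φ v ≠ φ u := by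
  rw [mem_nb] at hv
  intro h
  have := hφ.inj _ hv.2 (by simp) (by simp [hu]) h
  exact hv.1 (this ▸ hu)

theorem Colored.ne_adj (hφ : Colored Δ k φ) (hv : v ∈ nb Δ {u}) : φ v ≠ φ u :=
  hφ.ne (by simp) hv

theorem Colored.card_image (hφ : Colored Δ k φ) (he : e ∈ Δ) : #(e.image φ) = #e :=
  card_image_of_injOn (hφ.inj e he)

theorem Colored.card_nb (h : IsCx Δ i D) (hφ : Colored Δ k φ) (he : e ∈ Δ) :
    #((nb Δ e).image φ) + #e ≤ k := by
  rw [← hφ.card_image he, ← card_union_of_disjoint]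
  · refine (card_le_card ?_).trans hφ.card
    rw [← image_union]
    refine image_subset_image (union_subset h.sub_vert fun v hv => h.mem_vert_of_mem he hv)
  · rw [disjoint_left]
    simp only [mem_image, not_exists, not_and]
    rintro _ ⟨v, hv, rfl⟩ w hw h'
    exact hφ.ne hw hv h'.symm

theorem IsCx.link (h : IsCx Δ (i + 1) D) (hx : x ∈ nb Δ ∅) : IsCx (lk Δ x) i D where
  down := by
    intro e he f hf
    simp only [lk, mem_filter, mem_univ, true_and] at *
    exact ⟨fun h' => he.1 (hf h'), h.down _ he.2 _ (insert_subset_insert _ hf)⟩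
  empty := by simpa [lk] using mem_vert.1 hx
  ext := by
    intro e he hc
    simp only [lk, mem_filter, mem_univ, true_and] at he
    rw [nb_lk he.1]
    exact h.ext _ he.2 (by rw [card_insert_of_notMem he.1]; omega)
  deg := by
    intro e he hc
    simp only [lk, mem_filter, mem_univ, true_and] at he
    rw [nb_lk he.1]
    exact h.deg _ he.2 (by rw [card_insert_of_notMem he.1]; omega)
  nonneg := h.nonneg

theorem Colored.link (h : IsCx Δ i D) (hφ : Colored Δ (k + 1) φ) (hx : x ∈ nb Δ ∅) :
    Colored (lk Δ x) k φ where
  inj := by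
    intro e he
    simp only [lk, mem_filter, mem_univ, true_and] at he
    exact (hφ.inj _ he.2).mono (by simp)
  card := by
    rw [vert_lk]
    have := Colored.card_nb h hφ (mem_vert.1 hx)
    simpa using this

end UniqueColoring

namespace UniqueColoring

open Finset

section Counting

variable {α γ : Type*} [DecidableEq γ]

theorem card_common [DecidableEq α] {N : α → Finset α} {V B : Finset α} {M c : ℝ} (hV : (#V : ℝ) ≤ M)
    (hB : B.Nonempty) (h : ∀ a ∈ B, N a ⊆ V ∧ M - c < #(N a)) :
    M - #B * c < #{v ∈ V | ∀ a ∈ B, v ∈ N a} := by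
  induction hB using Finset.Nonempty.cons_induction with
  | singleton a =>
    obtain ⟨h1, h2⟩ := h a (by simp)
    have : {v ∈ V | ∀ b ∈ ({a} : Finset α), v ∈ N b} = N a := by
      ext v; simpa using fun h' => h1 h'
    rw [this]; simpa using h2
  | cons a B ha hB ih =>
    have ih' := ih fun b hb => h b (by simp [hb])
    obtain ⟨h1, h2⟩ := h a (by simp)
    have h3 : {v ∈ V | ∀ b ∈ cons a B ha, v ∈ N b} = {v ∈ V | ∀ b ∈ B, v ∈ N b} ∩ N a := by
      ext v
      simp only [mem_cons, forall_eq_or_imp, mem_filter, mem_inter]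
      tauto
    rw [h3, card_cons]
    have h4 := card_union_add_card_inter {v ∈ V | ∀ b ∈ B, v ∈ N b} (N a)
    have h5 : #({v ∈ V | ∀ b ∈ B, v ∈ N b} ∪ N a) ≤ #V :=
      card_le_card (union_subset (filter_subset _ _) h1)
    have h6 : (#{v ∈ V | ∀ b ∈ B, v ∈ N b} : ℝ) + #(N a) ≤
        #V + #({v ∈ V | ∀ b ∈ B, v ∈ N b} ∩ N a) := by
      norm_cast; omega
    push_cast
    linarith

theorem card_le_of_classes {S : Finset α} {C : Finset γ} {φ : α → γ} {t : ℝ}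
    (h : ∀ v ∈ S, φ v ∈ C) (ht : ∀ c ∈ C, (#{v ∈ S | φ v = c} : ℝ) ≤ t) :
    (#S : ℝ) ≤ #C * t := by
  rw [card_eq_sum_card_fiberwise h]
  push_cast
  simpa using sum_le_card_nsmul C _ t ht

end Counting

variable {α γ : Type*} [Fintype α] [DecidableEq α] [DecidableEq γ]

/-- Vertices having few non-neighbours. -/
def IsBad (Δ : Finset (Finset α)) (k : ℕ) (u : ℝ) (x : α) : Prop :=
  x ∈ nb Δ ∅ ∧ (3 * (k : ℝ) - 5) * u < #(nb Δ {x})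

/-- The inductive situation in which every vertex of the complex either has few non-neighbours or
has a neighbourhood on which the two colourings `φ` and `θ` agree. -/
structure Lvl (Δ : Finset (Finset α)) (i m k : ℕ) (u : ℝ) (φ θ : α → γ) : Prop where
  cx : IsCx Δ i ((3 * (m : ℝ) - 2) * u)
  colφ : Colored Δ k φ
  colθ : Colored Δ k θ
  pos : 0 < u
  hk : k = m + i
  hi : 1 ≤ i
  hm : i + 2 ≤ 3 * m
  size : (#(nb Δ ∅) : ℝ) ≤ (3 * (k : ℝ) - 2) * u
  dich : ∀ x ∈ nb Δ ∅, IsBad Δ k u x ∨ (2 ≤ i ∧ NoConf φ θ (nb Δ {x}))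

variable {Δ : Finset (Finset α)} {i m k : ℕ} {D u : ℝ} {φ θ : α → γ} {e f F S : Finset α}
  {v x y z : α}

theorem Colored.false_of_three (hφ : Colored Δ k φ) (hF : F ⊆ nb Δ ∅) (hinj : Set.InjOn φ F)
    (hc : #F + 2 = k) (hx : x ∈ nb Δ ∅) (hy : y ∈ nb Δ ∅) (hz : z ∈ nb Δ ∅)
    (hxF : φ x ∉ F.image φ) (hyF : φ y ∉ F.image φ) (hzF : φ z ∉ F.image φ)
    (hxy : φ x ≠ φ y) (hxz : φ x ≠ φ z) (hyz : φ y ≠ φ z) : False := by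
  have h1 : insert (φ x) (insert (φ y) (insert (φ z) (F.image φ))) ⊆ (nb Δ ∅).image φ := by
    simp only [insert_subset_iff]
    exact ⟨mem_image_of_mem _ hx, mem_image_of_mem _ hy, mem_image_of_mem _ hz,
      image_subset_image hF⟩
  have h2 := (card_le_card h1).trans hφ.card
  rw [card_insert_of_notMem (by simp only [mem_insert, not_or]; exact ⟨hxy, hxz, hxF⟩),
    card_insert_of_notMem (by simp only [mem_insert, not_or]; exact ⟨hyz, hyF⟩),
    card_insert_of_notMem hzF, card_image_of_injOn hinj] at h2
  omega

theorem Colored.notMem_image (hφ : Colored Δ k φ) (hF : F ⊆ nb Δ {x}) : φ x ∉ F.image φ := by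
  simp only [mem_image, not_exists, not_and]
  exact fun b hb => hφ.ne_adj (hF hb)

theorem not_mem_nb_self : x ∉ nb Δ {x} := by simp [mem_nb]

namespace Lvl

theorem swap (h : Lvl Δ i m k u φ θ) : Lvl Δ i m k u θ φ :=
  { h with
    colφ := h.colθ
    colθ := h.colφ
    dich := fun x hx => (h.dich x hx).imp_right fun ⟨h1, h2⟩ => ⟨h1, h2.swap⟩ }

theorem bad_of_conf (h : Lvl Δ i m k u φ θ) (hy : y ∈ nb Δ {x}) (hz : z ∈ nb Δ {x})
    (hyz : ¬ Compat φ θ y z) : IsBad Δ k u x :=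
  (h.dich x (h.cx.sub_vert (mem_nb_comm.1 hy))).resolve_right fun h' => hyz (h'.2 _ hy _ hz)

theorem card_common_bad (h : Lvl Δ i m k u φ θ) {B : Finset α} (hB : B.Nonempty)
    (hbad : ∀ b ∈ B, IsBad Δ k u b) (hc : #B + 1 ≤ k) :
    u < #{v ∈ nb Δ ∅ | ∀ a ∈ B, v ∈ nb Δ {a}} := by
  have h1 := card_common (N := fun a => nb Δ {a}) (c := 3 * u) h.size hB
    fun a ha => ⟨h.cx.sub_vert, by linarith [(hbad a ha).2]⟩
  have h2 : (#B : ℝ) + 1 ≤ k := by exact_mod_cast hc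
  refine (lt_of_le_of_lt ?_ h1).trans_eq (by congr!)
  linarith [mul_nonneg (sub_nonneg.2 h2) h.pos.le]

theorem card_lt_of_bad (h : Lvl Δ i m k u φ θ) (hz : IsBad Δ k u z) (hS : S ⊆ nb Δ ∅)
    (hd : Disjoint S (nb Δ {z})) : (#S : ℝ) < 3 * u := by
  have h1 : #S + #(nb Δ {z}) ≤ #(nb Δ ∅) := by
    rw [← card_union_of_disjoint hd]
    exact card_le_card (union_subset hS h.cx.sub_vert)
  have h2 : (#S : ℝ) + #(nb Δ {z}) ≤ #(nb Δ ∅) := by exact_mod_cast h1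
  linarith [hz.2, h.size]

theorem card_class_lt (h : Lvl Δ i m k u φ θ) (hz : IsBad Δ k u z) (hS : S ⊆ nb Δ ∅) :
    (#{v ∈ S | φ v = φ z} : ℝ) < 3 * u := by
  refine h.card_lt_of_bad hz ((filter_subset _ _).trans hS) ?_
  rw [disjoint_left]
  intro v hv hv'
  exact h.colφ.ne_adj hv' (mem_filter.1 hv).2

theorem one_le_m (h : Lvl Δ i m k u φ θ) : 1 ≤ m := by have := h.hm; omega

/-- The neighbours of `x` whose colours avoid those of `F`. -/
theorem card_private (h : Lvl Δ i m k u φ θ) (hx : x ∈ nb Δ ∅) (hF : F ⊆ nb Δ {x})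
    (hbad : ∀ b ∈ F, IsBad Δ k u b) (hφF : Set.InjOn φ F) (hc : #F + 2 = k) :
    u < #{v ∈ nb Δ {x} | φ v ∉ F.image φ ∧ θ v ∉ F.image θ} := by
  rcases h.dich x hx with hxb | ⟨hi2, hgood⟩
  · have hxF : x ∉ F := fun h' => not_mem_nb_self (hF h')
    refine (h.card_common_bad (B := insert x F) (insert_nonempty _ _) ?_ ?_).trans_le ?_
    · simpa [hxb] using hbad
    · rw [card_insert_of_notMem hxF]; omega
    · norm_cast
      refine card_le_card fun v hv => ?_
      simp only [mem_filter, mem_insert, forall_eq_or_imp] at hv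
      obtain ⟨-, h1, h2⟩ := hv
      simp only [mem_filter, h1, true_and, mem_image, not_exists, not_and]
      exact ⟨fun b hb hbv => h.colφ.ne_adj (h2 b hb) hbv.symm,
        fun b hb hbv => h.colθ.ne_adj (h2 b hb) hbv.symm⟩
  · set P := {v ∈ nb Δ {x} | φ v ∉ F.image φ ∧ θ v ∉ F.image θ} with hP
    have hnP : ∀ v ∈ nb Δ {x}, v ∉ P → φ v ∈ F.image φ := by
      intro v hv hvP
      by_contra hcon
      refine hvP (mem_filter.2 ⟨hv, hcon, ?_⟩)
      simp only [mem_image, not_exists, not_and] at hcon ⊢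
      exact fun b hb hbv => hcon b hb ((hgood b (hF hb) v hv).2 hbv)
    obtain ⟨E, hE, hxE, hEc⟩ := h.cx.exists_ext (mem_vert.1 hx) (j := i + 1)
      (by simp) le_rfl
    rw [singleton_subset_iff] at hxE
    have hF0 : F ⊆ nb Δ ∅ := hF.trans h.cx.sub_vert
    have huniq : ∀ p ∈ E, ∀ q ∈ E, p ∈ P → q ∈ P → p = q := by
      intro p hpE q hqE hp hq
      by_contra hpq
      rw [hP, mem_filter] at hp hq
      exact h.colφ.false_of_three hF0 hφF hc hx (h.cx.sub_vert hp.1) (h.cx.sub_vert hq.1)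
        (h.colφ.notMem_image hF) hp.2.1 hq.2.1 (h.colφ.ne_adj hp.1).symm
        (h.colφ.ne_adj hq.1).symm fun h' => hpq (h.colφ.inj E hE hpE hqE h')
    obtain ⟨p, hpE, hpx, hpu⟩ : ∃ p ∈ E, p ≠ x ∧ ∀ w ∈ E, w ≠ p → w ∉ P := by
      by_cases hex : ∃ p ∈ E, p ∈ P
      · obtain ⟨p, hpE, hp⟩ := hex
        refine ⟨p, hpE, ?_, fun w hw hwp hwP => hwp (huniq w hw p hpE hwP hp)⟩
        rintro rfl
        exact not_mem_nb_self (mem_filter.1 hp).1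
      · push Not at hex
        have : 1 < #E := by omega
        obtain ⟨p, hp, hpx⟩ := exists_mem_ne this x
        exact ⟨p, hp, hpx, fun w hw _ => hex w hw⟩
    have heΔ : E.erase p ∈ Δ := h.cx.down E hE _ (erase_subset _ _)
    have hec : #(E.erase p) = i := by rw [card_erase_of_mem hpE, hEc]; rfl
    have hxe : x ∈ E.erase p := mem_erase.2 ⟨hpx.symm, hxE⟩
    set e := E.erase p with he
    have hsub : (e.erase x).image φ ⊆ F.image φ := by
      intro c hc
      simp only [mem_image] at hc
      obtain ⟨w, hw, rfl⟩ := hc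
      obtain ⟨hwx, hwe⟩ := mem_erase.1 hw
      obtain ⟨hwp, hwE⟩ := mem_erase.1 hwe
      exact hnP w (h.cx.adj heΔ hxe hwe hwx) (hpu w hwE hwp)
    set C := F.image φ \ (e.erase x).image φ with hC
    have hCc : #C + 1 = m := by
      have h1 := card_sdiff_of_subset hsub
      rw [← hC, card_image_of_injOn hφF, h.colφ.card_image
        (h.cx.down _ heΔ _ (erase_subset _ _)), card_erase_of_mem hxe, hec] at h1
      have := h.hk; have := h.one_le_m; omega
    have h1 := h.cx.deg e heΔ hec
    have h2 := card_filter_add_card_filter_not (s := nb Δ e) (fun v => v ∈ P)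
    have h3 : #{v ∈ nb Δ e | v ∈ P} ≤ #P := card_le_card fun v hv => (mem_filter.1 hv).2
    have h4 : (#{v ∈ nb Δ e | v ∉ P} : ℝ) ≤ #C * (3 * u) := by
      refine card_le_of_classes (φ := φ) ?_ ?_
      · intro v hv
        rw [mem_filter] at hv
        refine mem_sdiff.2 ⟨hnP v (h.cx.adj_nb hxe hv.1) hv.2, ?_⟩
        simp only [mem_image, not_exists, not_and]
        exact fun w hw hwv => h.colφ.ne (mem_of_mem_erase hw) hv.1 hwv.symm
      · intro c hc
        obtain ⟨b, hb, rfl⟩ := mem_image.1 (mem_sdiff.1 hc).1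
        exact (h.card_class_lt (hbad b hb) ((filter_subset _ _).trans h.cx.sub_vert)).le
    have h5 : (#C : ℝ) + 1 = m := by exact_mod_cast hCc
    have h6 : (#(nb Δ e) : ℝ) ≤ #P + #{v ∈ nb Δ e | v ∉ P} := by exact_mod_cast (by omega)
    rw [← h5] at h1
    linarith

end Lvl

end UniqueColoring

namespace UniqueColoring

open Finset

theorem exists_subset_injOn_of_card_le {α γ : Type*} [DecidableEq γ] {φ : α → γ} {n : ℕ}
    {X : Finset α} (h : n ≤ #(X.image φ)) :
    ∃ F ⊆ X, #F = n ∧ Set.InjOn φ F := by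
  obtain ⟨T, hT, hTc⟩ := exists_subset_card_eq h
  obtain ⟨F, hF, hinj, him⟩ := exists_subset_injOn_image_eq_of_surjOn (f := φ) (X : Set α) T
    (by
      intro c hc
      simpa using hT hc)
  exact ⟨F, by exact_mod_cast hF, by rw [← hTc, ← him, card_image_of_injOn hinj], hinj⟩

variable {α γ : Type*} [Fintype α] [DecidableEq α] [DecidableEq γ]
variable {Δ : Finset (Finset α)} {i m k : ℕ} {D u : ℝ} {φ θ : α → γ} {e f F S : Finset α}
  {v x y z : α}

namespace Lvl

theorem exists_clique (h : Lvl Δ i m k u φ θ) (hz : IsBad Δ k u z) (hy : IsBad Δ k u y)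
    (hyz : ¬ Compat φ θ y z) (j : ℕ) (hj : j + 2 ≤ k) :
    ∃ F ⊆ nb Δ {y} ∩ nb Δ {z}, #F = j ∧ ∀ a ∈ F, ∀ b ∈ F, a ≠ b → a ∈ nb Δ {b} := by
  induction j with
  | zero => exact ⟨∅, by simp⟩
  | succ j ih =>
    obtain ⟨F, hF, hFc, hcl⟩ := ih (by omega)
    have hb : ∀ b ∈ insert y (insert z F), IsBad Δ k u b := by
      simp only [mem_insert, forall_eq_or_imp]
      refine ⟨hy, hz, fun b hb => ?_⟩
      have := mem_inter.1 (hF hb)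
      exact h.bad_of_conf (mem_nb_comm.1 this.1) (mem_nb_comm.1 this.2) hyz
    have h1 := h.card_common_bad (insert_nonempty _ _) hb (by
      have := card_insert_le y (insert z F)
      have := card_insert_le z F
      omega)
    have h2 : 0 < #{v ∈ nb Δ ∅ | ∀ a ∈ insert y (insert z F), v ∈ nb Δ {a}} := by
      exact_mod_cast h.pos.trans h1
    obtain ⟨w, hw⟩ := card_pos.1 h2
    simp only [mem_filter, mem_insert, forall_eq_or_imp] at hw
    obtain ⟨-, hwy, hwz, hwF⟩ := hw
    refine ⟨insert w F, insert_subset (mem_inter.2 ⟨hwy, hwz⟩) hF, ?_, ?_⟩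
    · rw [card_insert_of_notMem fun hw => not_mem_nb_self (hwF w hw), hFc]
    · simp only [mem_insert, forall_eq_or_imp, ne_eq, not_true_eq_false, false_implies, true_and]
      exact ⟨fun b hb _ => hwF b hb, fun a ha => ⟨fun _ => mem_nb_comm.1 (hwF a ha), hcl a ha⟩⟩

/-- A conflicting pair with a bad member has `k - 2` common neighbours, all of them bad, with
distinct colours in both colourings. -/
theorem exists_frame (h : Lvl Δ i m k u φ θ) (hz : IsBad Δ k u z) (hy : y ∈ nb Δ ∅)
    (hyz : ¬ Compat φ θ y z) :
    ∃ F ⊆ nb Δ {y} ∩ nb Δ {z}, #F + 2 = k ∧ (∀ b ∈ F, IsBad Δ k u b) ∧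
      Set.InjOn φ F ∧ Set.InjOn θ F := by
  have hk := h.hk
  have hi := h.hi
  have hm := h.hm
  have hXbad : ∀ b ∈ nb Δ {y} ∩ nb Δ {z}, IsBad Δ k u b := by
    intro b hb
    have := mem_inter.1 hb
    exact h.bad_of_conf (mem_nb_comm.1 this.1) (mem_nb_comm.1 this.2) hyz
  rcases h.dich y hy with hyb | ⟨hi2, hgood⟩
  · obtain ⟨F, hF, hFc, hcl⟩ := h.exists_clique hz hyb hyz (k - 2) (by omega)
    refine ⟨F, hF, by omega, fun b hb => hXbad b (hF hb), ?_, ?_⟩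
    · exact fun a ha b hb hab => by_contra fun hne => h.colφ.ne_adj (hcl a ha b hb hne) hab
    · exact fun a ha b hb hab => by_contra fun hne => h.colθ.ne_adj (hcl a ha b hb hne) hab
  · set X := nb Δ {y} ∩ nb Δ {z} with hX
    have hnon : ∀ S ⊆ nb Δ {y}, (#{v ∈ S | φ v ∉ X.image φ} : ℝ) < 3 * u := by
      intro S hS
      refine h.card_lt_of_bad hz (((filter_subset _ _).trans hS).trans h.cx.sub_vert) ?_
      rw [disjoint_left]
      intro v hv hvz
      rw [mem_filter] at hv
      exact hv.2 (mem_image_of_mem _ (mem_inter.2 ⟨hS hv.1, hvz⟩))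
    obtain ⟨e₀, he₀, hye₀, hc₀⟩ := h.cx.exists_ext (mem_vert.1 hy) (j := i) (by simpa) (by omega)
    obtain ⟨e, he, hmax⟩ := exists_max_image {e ∈ Δ | y ∈ e ∧ #e = i}
      (fun e => #{v ∈ e | φ v ∈ X.image φ}) ⟨e₀, by simpa [he₀, hc₀] using hye₀⟩
    simp only [mem_filter] at he hmax
    obtain ⟨heΔ, hye, hec⟩ := he
    have hsub : nb Δ e ⊆ nb Δ {y} := h.cx.nb_anti (by simpa)
    set C := {v ∈ nb Δ e | φ v ∈ X.image φ}.image φ with hC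
    have hCX : C ⊆ X.image φ := by
      intro c hc
      obtain ⟨v, hv, rfl⟩ := mem_image.1 hc
      exact (mem_filter.1 hv).2
    have hCm : m ≤ #C + 1 := by
      have h1 := h.cx.deg e heΔ hec
      have h2 := card_filter_add_card_filter_not (s := nb Δ e) (fun v => φ v ∈ X.image φ)
      have h3 := hnon _ hsub
      have h4 : (#{v ∈ nb Δ e | φ v ∈ X.image φ} : ℝ) ≤ #C * (3 * u) := by
        refine card_le_of_classes (φ := φ) (fun v hv => mem_image_of_mem _ hv) ?_
        intro c hc
        obtain ⟨b, hb, rfl⟩ := mem_image.1 (hCX hc)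
        exact (h.card_class_lt (hXbad b hb) ((filter_subset _ _).trans h.cx.sub_vert)).le
      have h5 : (#(nb Δ e) : ℝ) = #{v ∈ nb Δ e | φ v ∈ X.image φ} +
        #{v ∈ nb Δ e | φ v ∉ X.image φ} := by exact_mod_cast h2.symm
      have h6 : (3 * (m : ℝ) - 2) * u < (3 + 3 * #C) * u := by linarith
      have h7 : 3 * (m : ℝ) - 2 < 3 + 3 * #C := lt_of_mul_lt_mul_right h6 h.pos.le
      have h8 : 3 * m < 5 + 3 * #C := by
        have : (3 * m : ℝ) < 5 + 3 * #C := by linarith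
        exact_mod_cast this
      omega
    have hall : ∀ w ∈ e.erase y, φ w ∈ X.image φ := by
      intro w hw
      by_contra hwX
      obtain ⟨hwy, hwe⟩ := mem_erase.1 hw
      have : 0 < #C := by omega
      obtain ⟨_, hc⟩ := card_pos.1 this
      obtain ⟨v, hv, -⟩ := mem_image.1 hc
      rw [mem_filter, mem_nb] at hv
      obtain ⟨⟨hve, hveΔ⟩, hvX⟩ := hv
      have hv' : v ∉ e.erase w := fun h' => hve (mem_of_mem_erase h')
      have h1 := hmax (insert v (e.erase w)) ⟨h.cx.down _ hveΔ _
          (insert_subset_insert _ (erase_subset _ _)),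
        mem_insert_of_mem (mem_erase.2 ⟨hwy.symm, hye⟩), by
          rw [card_insert_of_notMem hv', card_erase_of_mem hwe]; omega⟩
      have h2 : insert v {x ∈ e | φ x ∈ X.image φ} ⊆
          {x ∈ insert v (e.erase w) | φ x ∈ X.image φ} := by
        intro x hx
        rcases mem_insert.1 hx with rfl | hx
        · exact mem_filter.2 ⟨mem_insert_self _ _, hvX⟩
        · rw [mem_filter] at hx
          exact mem_filter.2 ⟨mem_insert_of_mem (mem_erase.2
            ⟨fun h' => hwX (h' ▸ hx.2), hx.1⟩), hx.2⟩
      have h3 := card_le_card h2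
      rw [card_insert_of_notMem fun h' => hve (mem_filter.1 h').1] at h3
      omega
    have hXc : k - 2 ≤ #(X.image φ) := by
      have h1 : C ∪ (e.erase y).image φ ⊆ X.image φ := by
        refine union_subset hCX fun c hc => ?_
        obtain ⟨w, hw, rfl⟩ := mem_image.1 hc
        exact hall w hw
      have h2 : Disjoint C ((e.erase y).image φ) := by
        rw [disjoint_left]
        intro c hc hc'
        obtain ⟨v, hv, rfl⟩ := mem_image.1 hc
        obtain ⟨w, hw, hwv⟩ := mem_image.1 hc'
        exact h.colφ.ne (mem_of_mem_erase hw) (mem_filter.1 hv).1 hwv.symm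
      have h3 := card_le_card h1
      rw [card_union_of_disjoint h2, h.colφ.card_image (h.cx.down _ heΔ _ (erase_subset _ _)),
        card_erase_of_mem hye] at h3
      omega
    obtain ⟨F, hF, hFc, hinj⟩ := exists_subset_injOn_of_card_le hXc
    refine ⟨F, hF, by omega, fun b hb => hXbad b (hF hb), hinj, fun a ha b hb hab => ?_⟩
    exact hinj ha hb ((hgood a (mem_inter.1 (hF ha)).1 b (mem_inter.1 (hF hb)).1).2 hab)

theorem false_of_bad_conf (h : Lvl Δ i m k u φ θ) (hz : IsBad Δ k u z) (hy : y ∈ nb Δ ∅)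
    (hφ : φ y = φ z) (hθ : θ y ≠ θ z) : False := by
  have hyz : ¬ Compat φ θ y z := fun h' => hθ (h'.1 hφ)
  have hzV := hz.1
  obtain ⟨F, hF, hFc, hFb, hFφ, hFθ⟩ := h.exists_frame hz hy hyz
  have hFy : F ⊆ nb Δ {y} := hF.trans inter_subset_left
  have hFz : F ⊆ nb Δ {z} := hF.trans inter_subset_right
  have hFV : F ⊆ nb Δ ∅ := hFy.trans h.cx.sub_vert
  set P := {v ∈ nb Δ {y} | φ v ∉ F.image φ ∧ θ v ∉ F.image θ} with hP
  have hPu : u < #P := h.card_private hy hFy hFb hFφ hFc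
  have hP1 : ∀ p ∈ P, φ p ≠ φ z ∧ θ p = θ z := by
    intro p hp
    obtain ⟨hpy, -, hpθ⟩ := mem_filter.1 hp
    refine ⟨hφ ▸ h.colφ.ne_adj hpy, ?_⟩
    by_contra hpz
    exact h.colθ.false_of_three hFV hFθ hFc hy hzV (h.cx.sub_vert hpy)
      (h.colθ.notMem_image hFy) (h.colθ.notMem_image hFz) hpθ hθ (h.colθ.ne_adj hpy).symm
      (Ne.symm hpz)
  obtain ⟨y', hy'⟩ : P.Nonempty := card_pos.1 (by exact_mod_cast h.pos.trans hPu)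
  have hy'V : y' ∈ nb Δ ∅ := h.cx.sub_vert (mem_filter.1 hy').1
  obtain ⟨hφ', hθ'⟩ := hP1 y' hy'
  obtain ⟨G, hG, hGc, hGb, hGφ, hGθ⟩ := h.exists_frame hz hy'V fun h' => hφ' (h'.2 hθ')
  have hGy : G ⊆ nb Δ {y'} := hG.trans inter_subset_left
  have hGz : G ⊆ nb Δ {z} := hG.trans inter_subset_right
  set Q := {v ∈ nb Δ {y'} | φ v ∉ G.image φ ∧ θ v ∉ G.image θ} with hQ
  have hQu : u < #Q := h.card_private hy'V hGy hGb hGφ hGc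
  have hQ1 : ∀ p ∈ Q, φ p = φ z ∧ θ p ≠ θ z := by
    intro p hp
    obtain ⟨hpy, hpφ, -⟩ := mem_filter.1 hp
    refine ⟨?_, hθ' ▸ h.colθ.ne_adj hpy⟩
    by_contra hpz
    exact h.colφ.false_of_three (hGy.trans h.cx.sub_vert) hGφ hGc hy'V hzV (h.cx.sub_vert hpy)
      (h.colφ.notMem_image hGy) (h.colφ.notMem_image hGz) hpφ hφ' (h.colφ.ne_adj hpy).symm
      (Ne.symm hpz)
  have hzF : z ∉ F := fun h' => not_mem_nb_self (hFz h')
  have h1 := h.card_common_bad (B := insert z F) (insert_nonempty _ _)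
    (by simpa [hz] using hFb) (by rw [card_insert_of_notMem hzF]; omega)
  obtain ⟨z', hz'⟩ := card_pos.1 (by exact_mod_cast h.pos.trans h1)
  simp only [mem_filter, mem_insert, forall_eq_or_imp] at hz'
  obtain ⟨hz'V, hz'z, hz'F⟩ := hz'
  have hFz' : F ⊆ nb Δ {z'} := fun b hb => mem_nb_comm.1 (hz'F b hb)
  set R := {v ∈ nb Δ {z'} | φ v ∉ F.image φ ∧ θ v ∉ F.image θ} with hR
  have hRu : u < #R := h.card_private hz'V hFz' hFb hFφ hFc
  have hR1 : ∀ p ∈ R, φ p = φ z ∧ θ p = θ z := by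
    intro p hp
    obtain ⟨hpz', hpφ, hpθ⟩ := mem_filter.1 hp
    constructor
    · by_contra hpz
      exact h.colφ.false_of_three hFV hFφ hFc hz'V hzV (h.cx.sub_vert hpz')
        (h.colφ.notMem_image hFz') (h.colφ.notMem_image hFz) hpφ (h.colφ.ne_adj hz'z)
        (h.colφ.ne_adj hpz').symm (Ne.symm hpz)
    · by_contra hpz
      exact h.colθ.false_of_three hFV hFθ hFc hz'V hzV (h.cx.sub_vert hpz')
        (h.colθ.notMem_image hFz') (h.colθ.notMem_image hFz) hpθ (h.colθ.ne_adj hz'z)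
        (h.colθ.ne_adj hpz').symm (Ne.symm hpz)
  have hPQ : Disjoint P Q := by
    rw [disjoint_left]; exact fun p hp hq => (hP1 p hp).1 (hQ1 p hq).1
  have hPQR : Disjoint (P ∪ Q) R := by
    rw [disjoint_left]
    intro p hp hr
    rcases mem_union.1 hp with hp | hp
    · exact (hP1 p hp).1 (hR1 p hr).1
    · exact (hQ1 p hp).2 (hR1 p hr).2
  have h2 : (#(P ∪ Q ∪ R) : ℝ) < 3 * u := by
    refine h.card_lt_of_bad hz ?_ ?_
    · refine union_subset (union_subset ?_ ?_) ?_ <;>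
        exact (filter_subset _ _).trans h.cx.sub_vert
    · rw [disjoint_left]
      intro p hp hpz
      simp only [mem_union, or_assoc] at hp
      rcases hp with hp | hp | hp
      · exact h.colθ.ne_adj hpz (hP1 p hp).2
      · exact h.colφ.ne_adj hpz (hQ1 p hp).1
      · exact h.colφ.ne_adj hpz (hR1 p hp).1
  rw [card_union_of_disjoint hPQR, card_union_of_disjoint hPQ] at h2
  push_cast at h2
  linarith

theorem compat_of_bad (h : Lvl Δ i m k u φ θ) (hz : IsBad Δ k u z) (hy : y ∈ nb Δ ∅) :
    Compat φ θ y z :=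
  ⟨fun hφ => by_contra fun hθ => h.false_of_bad_conf hz hy hφ hθ,
    fun hθ => by_contra fun hφ => h.swap.false_of_bad_conf hz hy hθ hφ⟩

end Lvl

end UniqueColoring

namespace UniqueColoring

open Finset

theorem mul_le_card_of_classes {α γ : Type*} [DecidableEq γ] {S : Finset α} {C : Finset γ}
    {φ : α → γ} {t : ℝ} (ht : ∀ c ∈ C, t ≤ (#{v ∈ S | φ v = c} : ℝ)) : #C * t ≤ (#S : ℝ) := by
  have h1 : ∀ v ∈ {v ∈ S | φ v ∈ C}, φ v ∈ C := fun v hv => (mem_filter.1 hv).2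
  have h2 := card_eq_sum_card_fiberwise h1
  have h3 : (#{v ∈ S | φ v ∈ C} : ℝ) ≤ #S := by exact_mod_cast card_filter_le _ _
  refine le_trans ?_ h3
  rw [h2]
  push_cast
  have h4 : ∀ c ∈ C, t ≤ (#{v ∈ {v ∈ S | φ v ∈ C} | φ v = c} : ℝ) := by
    intro c hc
    convert ht c hc using 3
    rw [filter_filter]
    refine filter_congr fun v _ => ?_
    constructor
    · exact fun h => h.2
    · rintro rfl; exact ⟨hc, rfl⟩
  simpa using card_nsmul_le_sum C _ t h4

variable {α γ : Type*} [Fintype α] [DecidableEq α] [DecidableEq γ]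
variable {Δ : Finset (Finset α)} {i m k : ℕ} {D u : ℝ} {φ θ : α → γ} {e f F S : Finset α}
  {v x y z : α}

/-- The degree of `v` off a set of small colour classes, from a face through `v` whose colour
classes in the neighbourhood of `v` are as large as possible. -/
theorem exists_pivot (h : IsCx Δ i D) (hφ : Colored Δ (m + i) φ) (hi : 2 ≤ i) (hv : v ∈ nb Δ ∅)
    {τ : ℝ} (hτ : D ≤ m * τ) (C₀ : Finset γ)
    (hC₀ : ∀ c ∈ C₀, (#{w ∈ nb Δ {v} | φ w = c} : ℝ) ≤ τ) :
    ∃ σ : ℝ, D ≤ m * σ ∧ σ ≤ τ ∧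
      (∀ C ⊆ C₀, D + ((i : ℝ) - 1 - #C) * σ < #{w ∈ nb Δ {v} | φ w ∉ C}) ∧
      ∃ T : Finset γ, #T + 1 = i ∧ φ v ∉ T ∧
        ∀ c ∈ T, D < m * (#{w ∈ nb Δ {v} | φ w = c} : ℝ) := by
  set g : γ → ℕ := fun c => #{w ∈ nb Δ {v} | φ w = c} with hg
  obtain ⟨e₀, he₀, hye₀, hc₀⟩ := h.exists_ext (mem_vert.1 hv) (j := i)
    (by simp only [card_singleton]; omega) (by omega)
  obtain ⟨e, he, hmax⟩ := exists_max_image {e ∈ Δ | v ∈ e ∧ #e = i}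
    (fun e => ∑ s ∈ e.erase v, g (φ s)) ⟨e₀, by simpa [he₀, hc₀] using hye₀⟩
  simp only [mem_filter] at he hmax
  obtain ⟨heΔ, hve, hec⟩ := he
  have hecv : #(e.erase v) + 1 = i := by rw [card_erase_of_mem hve]; omega
  obtain ⟨s, hs, hmin⟩ := exists_min_image (e.erase v) (fun s => g (φ s))
    (card_pos.1 (by omega))
  have hle : ∀ w ∈ nb Δ e, g (φ w) ≤ g (φ s) := by
    intro w hw
    have hwv := not_mem_nb_self (Δ := Δ) (x := v)
    have hwv' : w ∈ nb Δ {v} := h.adj_nb hve hw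
    have hne : w ≠ v := by rintro rfl; exact hwv hwv'
    rw [mem_nb] at hw
    obtain ⟨hsv, hse⟩ := mem_erase.1 hs
    have hw' : w ∉ e.erase s := fun h' => hw.1 (mem_of_mem_erase h')
    have h1 := hmax (insert w (e.erase s)) ⟨h.down _ hw.2 _
        (insert_subset_insert _ (erase_subset _ _)),
      mem_insert_of_mem (mem_erase.2 ⟨hsv.symm, hve⟩), by
        rw [card_insert_of_notMem hw', card_erase_of_mem hse]; omega⟩
    rw [erase_insert_of_ne hne, erase_right_comm,
      sum_insert fun h' => hw.1 (mem_of_mem_erase (mem_of_mem_erase h')),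
      ← add_sum_erase _ _ hs] at h1
    omega
  have hfib : ∀ S ⊆ nb Δ e, ∀ c, #{w ∈ S | φ w = c} ≤ g c := fun S hS c =>
    card_le_card (filter_subset_filter _ (hS.trans (h.nb_anti (by simpa))))
  have hcm : #((nb Δ e).image φ) ≤ m := by
    have := hφ.card_nb h heΔ; omega
  have hσ₀ : D < m * g (φ s) := by
    refine (h.deg e heΔ hec).trans_le ?_
    refine (card_le_of_classes (φ := φ) (fun w hw => mem_image_of_mem _ hw)
      (t := g (φ s)) ?_).trans ?_
    · intro c hc
      obtain ⟨w, hw, rfl⟩ := mem_image.1 hc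
      exact_mod_cast (hfib _ Subset.rfl _).trans (hle w hw)
    · gcongr
  have hmpos : (0 : ℝ) < m := by
    rcases Nat.eq_zero_or_pos m with rfl | h'
    · have := h.nonneg
      simp only [CharP.cast_eq_zero, zero_mul] at hσ₀
      linarith
    · exact_mod_cast h'
  have hτ0 : 0 ≤ τ := by
    by_contra hcon
    push Not at hcon
    nlinarith [h.nonneg]
  refine ⟨min (g (φ s)) τ, ?_, min_le_right _ _, ?_, (e.erase v).image φ, ?_, ?_, ?_⟩
  · rcases min_choice (g (φ s) : ℝ) τ with h' | h' <;> rw [h']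
    exacts [hσ₀.le, hτ]
  · intro C hC
    set σ := min (g (φ s) : ℝ) τ with hσ
    have hσ0 : 0 ≤ σ := le_min (by positivity) hτ0
    set A := {w ∈ nb Δ {v} | φ w ∉ C} with hA
    set T := (e.erase v).image φ \ C with hT
    set C' := C ∩ (nb Δ e).image φ with hC'
    have h1 : (#T : ℝ) * σ ≤ #{w ∈ A | φ w ∈ T} := by
      refine mul_le_card_of_classes (φ := φ) fun c hc => (min_le_left _ _).trans ?_
      have h2 : {w ∈ {w ∈ A | φ w ∈ T} | φ w = c} = {w ∈ nb Δ {v} | φ w = c} := by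
        ext w
        simp only [hA, mem_filter]
        constructor
        · exact fun h' => ⟨h'.1.1.1, h'.2⟩
        · rintro ⟨h', rfl⟩; exact ⟨⟨⟨h', (mem_sdiff.1 hc).2⟩, hc⟩, rfl⟩
      rw [h2]
      obtain ⟨s', hs', rfl⟩ := mem_image.1 (mem_sdiff.1 hc).1
      exact_mod_cast hmin s' hs'
    have h2 : #{w ∈ nb Δ e | φ w ∉ C} ≤ #{w ∈ A | φ w ∉ T} := by
      refine card_le_card fun w hw => ?_
      obtain ⟨hwe, hwC⟩ := mem_filter.1 hw
      refine mem_filter.2 ⟨mem_filter.2 ⟨h.adj_nb hve hwe, hwC⟩, fun h' => ?_⟩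
      obtain ⟨s', hs', hsw⟩ := mem_image.1 (mem_sdiff.1 h').1
      exact hφ.ne (mem_of_mem_erase hs') hwe hsw.symm
    have h3 : (#{w ∈ nb Δ e | φ w ∈ C} : ℝ) ≤ #C' * σ := by
      refine card_le_of_classes (φ := φ) ?_ ?_
      · intro w hw
        obtain ⟨hwe, hwC⟩ := mem_filter.1 hw
        exact mem_inter.2 ⟨hwC, mem_image_of_mem _ hwe⟩
      · intro c hc
        obtain ⟨hcC, hce⟩ := mem_inter.1 hc
        have h4 : (#{w ∈ {w ∈ nb Δ e | φ w ∈ C} | φ w = c} : ℝ) ≤ g c := by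
          exact_mod_cast hfib _ (filter_subset _ _) c
        refine h4.trans (le_min ?_ (hC₀ c (hC hcC)))
        obtain ⟨w, hw, rfl⟩ := mem_image.1 hce
        exact_mod_cast hle w hw
    have h4 : i ≤ #T + 1 + #C - #C' ∧ #C' ≤ #C := by
      have h5 : #T + #((e.erase v).image φ ∩ C) + 1 = i := by
        rw [card_sdiff_add_card_inter, hφ.card_image (h.down _ heΔ _ (erase_subset _ _)), hecv]
      have h6 : Disjoint ((e.erase v).image φ ∩ C) C' := by
        rw [disjoint_left]
        intro c hc hc'
        obtain ⟨s', hs', rfl⟩ := mem_image.1 (mem_inter.1 hc).1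
        obtain ⟨w, hw, hws⟩ := mem_image.1 (mem_inter.1 hc').2
        exact hφ.ne (mem_of_mem_erase hs') hw hws
      have h7 := card_le_card (union_subset inter_subset_right inter_subset_left :
        (e.erase v).image φ ∩ C ∪ C' ⊆ C)
      rw [card_union_of_disjoint h6] at h7
      omega
    have h5 : (i : ℝ) + #C' ≤ #T + 1 + #C := by
      have : i + #C' ≤ #T + 1 + #C := by omega
      exact_mod_cast this
    have h6 := card_filter_add_card_filter_not (s := A) (fun w => φ w ∈ T)
    have h7 := card_filter_add_card_filter_not (s := nb Δ e) (fun w => φ w ∈ C)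
    have h8 : (#(nb Δ e) : ℝ) + #{w ∈ A | φ w ∈ T} ≤ #A + #{w ∈ nb Δ e | φ w ∈ C} := by
      exact_mod_cast (by omega)
    have h9 := h.deg e heΔ hec
    nlinarith [mul_nonneg hσ0 (sub_nonneg.2 h5)]
  · rw [hφ.card_image (h.down _ heΔ _ (erase_subset _ _)), hecv]
  · simp only [mem_image, mem_erase, not_exists, not_and, and_imp]
    exact fun w hwv hwe hw => hwv (hφ.inj e heΔ hwe hve hw)
  · intro c hc
    obtain ⟨s', hs', rfl⟩ := mem_image.1 hc
    refine hσ₀.trans_le ?_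
    gcongr
    exact hmin s' hs'

end UniqueColoring

namespace UniqueColoring

open Finset

theorem interpolate {M D σ u R c a : ℝ} (hM : 0 < M) (h₁ : D ≤ M * σ) (h₂ : σ ≤ 3 * u)
    (h₃ : M * R ≤ (c * M + a) * D) (h₄ : R ≤ c * D + 3 * a * u) : R ≤ c * D + a * σ := by
  rcases le_total 0 a with ha | ha
  · refine le_of_mul_le_mul_left ?_ hM
    nlinarith [mul_le_mul_of_nonneg_left h₁ ha]
  · nlinarith [mul_le_mul_of_nonpos_left h₂ ha]

variable {α γ : Type*} [Fintype α] [DecidableEq α] [DecidableEq γ]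
variable {Δ : Finset (Finset α)} {i m k : ℕ} {D u : ℝ} {φ θ : α → γ} {e f F S : Finset α}
  {v x y z : α}

namespace Lvl

/-- The colours of the bad vertices. -/
theorem exists_light (h : Lvl Δ i m k u φ θ) :
    ∃ C : Finset γ, (∀ b, IsBad Δ k u b → φ b ∈ C) ∧
      #C + #({v ∈ nb Δ ∅ | φ v ∉ C}.image φ) ≤ k ∧
      #C + #({v ∈ nb Δ ∅ | φ v ∉ C}.image θ) ≤ k ∧
      ∀ c ∈ C, ∃ b, IsBad Δ k u b ∧ φ b = c := by
  classical
  set B := {v ∈ nb Δ ∅ | IsBad Δ k u v} with hB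
  have hBV : B ⊆ nb Δ ∅ := filter_subset _ _
  have hcolor : ∀ c ∈ B.image φ, ∃ b, IsBad Δ k u b ∧ φ b = c := by
    intro c hc
    obtain ⟨b, hb, rfl⟩ := mem_image.1 hc
    exact ⟨b, (mem_filter.1 hb).2, rfl⟩
  have hmem : ∀ b, IsBad Δ k u b → φ b ∈ B.image φ := fun b hb =>
    mem_image_of_mem _ (mem_filter.2 ⟨hb.1, hb⟩)
  refine ⟨B.image φ, hmem, ?_, ?_, hcolor⟩
  · rw [← card_union_of_disjoint]
    · refine (card_le_card ?_).trans h.colφ.card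
      exact union_subset (image_subset_image hBV) (image_subset_image (filter_subset _ _))
    · rw [disjoint_left]
      intro c hc hc'
      obtain ⟨v, hv, rfl⟩ := mem_image.1 hc'
      exact (mem_filter.1 hv).2 hc
  · obtain ⟨F, hF, hFc, hinj⟩ := exists_subset_injOn_of_card_le (le_refl #(B.image φ))
    have hθF : Set.InjOn θ F := fun a ha b hb hab => hinj ha hb
      ((h.compat_of_bad (mem_filter.1 (hF hb)).2 (hBV (hF ha))).2 hab)
    rw [← hFc, ← card_image_of_injOn hθF, ← card_union_of_disjoint]
    · refine (card_le_card ?_).trans h.colθ.card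
      exact union_subset (image_subset_image (hF.trans hBV))
        (image_subset_image (filter_subset _ _))
    · rw [disjoint_left]
      intro c hc hc'
      obtain ⟨b, hb, rfl⟩ := mem_image.1 hc
      obtain ⟨v, hv, hvb⟩ := mem_image.1 hc'
      obtain ⟨hvV, hvC⟩ := mem_filter.1 hv
      have hbad := (mem_filter.1 (hF hb)).2
      exact hvC ((h.compat_of_bad hbad hvV).2 hvb ▸ hmem b hbad)

set_option maxHeartbeats 1000000 in
/-- Suppose `φ` identifies `y` and `z` while `θ` does not. The complement of the bad colours has at
least two colours; the number of them decides which neighbourhoods can be packed disjointly. -/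
theorem false_of_conf (h : Lvl Δ i m k u φ θ) (hy : y ∈ nb Δ ∅) (hz : z ∈ nb Δ ∅)
    (hφ : φ y = φ z) (hθ : θ y ≠ θ z) : False := by
  have hyz : ¬ Compat φ θ y z := fun h' => hθ (h'.1 hφ)
  have hyb : ¬ IsBad Δ k u y := fun h' => hyz (h.compat_of_bad h' hz).comm
  have hzb : ¬ IsBad Δ k u z := fun h' => hyz (h.compat_of_bad h' hy)
  obtain ⟨hi2, -⟩ := (h.dich y hy).resolve_left hyb
  have hk := h.hk
  have hm := h.hm
  have hu := h.pos
  have hm2 : 2 ≤ m := by omega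
  obtain ⟨C, hC, hKφ, hKθ, hlight⟩ := h.exists_light
  have hq : ∀ c ∈ C, ∀ S ⊆ nb Δ ∅, (#{v ∈ S | φ v = c} : ℝ) ≤ 3 * u := by
    intro c hc S hS
    obtain ⟨b, hb, rfl⟩ := hlight c hc
    exact (h.card_class_lt hb hS).le
  set N : α → Finset α := fun x => {w ∈ nb Δ {x} | φ w ∉ C} with hN
  set A := {v ∈ nb Δ ∅ | φ v ∉ C} with hA
  have hNA : ∀ x, N x ⊆ A := fun x => filter_subset_filter _ h.cx.sub_vert
  have hdisj : ∀ x x', ¬ Compat φ θ x x' → Disjoint (N x) (N x') := by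
    intro x x' hxx
    rw [disjoint_left]
    intro w hw hw'
    obtain ⟨h1, h2⟩ := mem_filter.1 hw
    exact h2 (hC w (h.bad_of_conf (mem_nb_comm.1 h1) (mem_nb_comm.1 (mem_filter.1 hw').1) hxx))
  have hpivot : ∀ x ∈ nb Δ ∅, ∃ σ : ℝ, (3 * (m : ℝ) - 2) * u ≤ m * σ ∧ σ ≤ 3 * u ∧
      (3 * (m : ℝ) - 2) * u + ((i : ℝ) - 1 - #C) * σ < #(N x) ∧
      (3 * (m : ℝ) - 2) * u + ((i : ℝ) - 1) * σ < #{w ∈ nb Δ ∅ | φ w ∈ C} + #(N x) := by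
    intro x hx
    obtain ⟨σ, h1, h2, h3, -⟩ := exists_pivot h.cx (hk ▸ h.colφ) hi2 hx (τ := 3 * u)
      (by nlinarith) C fun c hc => hq c hc _ h.cx.sub_vert
    refine ⟨σ, h1, h2, h3 C Subset.rfl, ?_⟩
    have h4 := h3 ∅ (empty_subset _)
    simp only [card_empty, Nat.cast_zero, sub_zero, notMem_empty, not_false_eq_true,
      filter_true] at h4
    refine h4.trans_le ?_
    have h5 := card_filter_add_card_filter_not (s := nb Δ {x}) (fun w => φ w ∈ C)
    have h6 : #{w ∈ nb Δ {x} | φ w ∈ C} ≤ #{w ∈ nb Δ ∅ | φ w ∈ C} :=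
      card_le_card (filter_subset_filter _ h.cx.sub_vert)
    have h7 : #(nb Δ {x}) ≤ #{w ∈ nb Δ ∅ | φ w ∈ C} + #(N x) := by
      rw [← h5]; exact Nat.add_le_add_right h6 _
    exact_mod_cast h7
  have hsize : (#{w ∈ nb Δ ∅ | φ w ∈ C} : ℝ) + #A ≤ (3 * (k : ℝ) - 2) * u := by
    refine le_trans (le_of_eq ?_) h.size
    exact_mod_cast card_filter_add_card_filter_not (s := nb Δ ∅) (fun w => φ w ∈ C)
  have hgood : ∀ x ∈ A, NoConf φ θ (nb Δ {x}) := by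
    intro x hx
    obtain ⟨hxV, hxC⟩ := mem_filter.1 hx
    exact ((h.dich x hxV).resolve_left fun h' => hxC (hC x h')).2
  have hconfA : ∀ y ∈ nb Δ ∅, ∀ z ∈ nb Δ ∅, φ y = φ z → θ y ≠ θ z → y ∈ A := by
    intro y hy z hz hφ hθ
    refine mem_filter.2 ⟨hy, fun hyC => ?_⟩
    obtain ⟨b, hb, hby⟩ := hlight _ hyC
    exact hθ (((h.compat_of_bad hb hy).1 hby.symm).trans
      ((h.compat_of_bad hb hz).1 (hφ.symm.trans hby.symm)).symm)
  have hyA := hconfA y hy z hz hφ hθ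
  have hzA := hconfA z hz y hy hφ.symm hθ.symm
  choose! σ hσ₁ hσ₂ hσ₃ hσ₄ using hpivot
  have hAV : A ⊆ nb Δ ∅ := filter_subset _ _
  have hsep : ∀ y ∈ nb Δ ∅, ∀ z ∈ nb Δ ∅, φ y = φ z → θ y ≠ θ z → #C + 3 = k ∨ #C + 2 = k →
      ∀ z' ∈ N z, Disjoint (N y) (N z') := by
    intro y hy z hz hφ hθ hCk z' hz'
    rw [disjoint_left]
    intro w hw hw'
    have hyA := hconfA y hy z hz hφ hθ
    have hzA := hconfA z hz y hy hφ.symm hθ.symm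
    have hwA := hNA _ hw
    have hz'A := hNA _ hz'
    by_cases hc : Compat φ θ y z'
    · have h1 : φ z' ≠ φ z := h.colφ.ne_adj (mem_filter.1 hz').1
      have h2 : φ w ≠ φ y := h.colφ.ne_adj (mem_filter.1 hw).1
      have h3 : θ y ≠ θ z' := fun h' => h1 ((hc.2 h').symm.trans hφ)
      have h4 : θ w ≠ θ z := fun h' => h2 (((hgood z' hz'A w (mem_filter.1 hw').1 z
        (mem_nb_comm.1 (mem_filter.1 hz').1)).2 h').trans hφ.symm)
      have h5 : ({θ w, θ y, θ z, θ z'} : Finset γ) ⊆ A.image θ := by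
        simp only [insert_subset_iff, singleton_subset_iff]
        exact ⟨mem_image_of_mem _ hwA, mem_image_of_mem _ hyA, mem_image_of_mem _ hzA,
          mem_image_of_mem _ hz'A⟩
      have h6 : #({θ w, θ y, θ z, θ z'} : Finset γ) = 4 := by
        rw [card_insert_of_notMem, card_insert_of_notMem, card_insert_of_notMem, card_singleton]
        · simpa using (h.colθ.ne_adj (mem_filter.1 hz').1).symm
        · simpa using ⟨hθ, h3⟩
        · simpa using ⟨h.colθ.ne_adj (mem_filter.1 hw).1, h4, h.colθ.ne_adj (mem_filter.1 hw').1⟩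
      have := card_le_card h5
      omega
    · exact disjoint_left.1 (hdisj _ _ hc) hw hw'
  have h2K : 2 ≤ #(A.image θ) := by
    have h1 : ({θ y, θ z} : Finset γ) ⊆ A.image θ := by
      simp only [insert_subset_iff, singleton_subset_iff]
      exact ⟨mem_image_of_mem _ hyA, mem_image_of_mem _ hzA⟩
    simpa [card_pair hθ] using card_le_card h1
  have hkR : (k : ℝ) = m + i := by exact_mod_cast hk
  have hmR : (i : ℝ) + 2 ≤ 3 * m := by exact_mod_cast hm
  have hm2R : (2 : ℝ) ≤ m := by exact_mod_cast hm2
  have hσ0 : ∀ x ∈ nb Δ ∅, 0 ≤ σ x := fun x hx => by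
    have := hσ₁ x hx
    by_contra hcon
    push Not at hcon
    nlinarith
  obtain hK | hK | hK : #C + 2 = k ∨ #C + 3 = k ∨ #C + 4 ≤ k := by omega
  · have hKR : (#C : ℝ) + 2 = k := by exact_mod_cast hK
    have hpos : ∀ x ∈ nb Δ ∅, (N x).Nonempty := by
      intro x hx
      rw [← card_pos]
      have h1 := hσ₃ x hx
      rw [(by linarith : (i : ℝ) - 1 - #C = -(m - 1))] at h1
      have h2 : (0 : ℝ) < #(N x) := by
        linarith [mul_le_mul_of_nonneg_left (hσ₂ x hx) (by linarith : 0 ≤ (m : ℝ) - 1)]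
      exact_mod_cast h2
    obtain ⟨y', hy'⟩ := hpos y hy
    obtain ⟨z', hz'⟩ := hpos z hz
    have hy'A := hNA _ hy'
    have hz'A := hNA _ hz'
    have htwo : ∀ ψ : α → γ, #(A.image ψ) ≤ 2 → ∀ a ∈ A, ∀ b ∈ A, ∀ c ∈ A,
        ψ b ≠ ψ a → ψ c ≠ ψ a → ψ b = ψ c := by
      intro ψ h2 a ha b hb c hc hba hca
      by_contra hbc
      have h1 : ({ψ a, ψ b, ψ c} : Finset γ) ⊆ A.image ψ := by
        simp only [insert_subset_iff, singleton_subset_iff]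
        exact ⟨mem_image_of_mem _ ha, mem_image_of_mem _ hb, mem_image_of_mem _ hc⟩
      have h3 := card_le_card h1
      rw [card_eq_three.2 ⟨_, _, _, hba.symm, hca.symm, hbc, rfl⟩] at h3
      omega
    have hφ2 := htwo φ (by omega)
    have hθ2 := htwo θ (by omega)
    have hadj : ∀ x ∈ A, ∀ x' ∈ N x, Disjoint (N x) (N x') := by
      intro x hx x' hx'
      rw [disjoint_left]
      intro w hw hw'
      exact h.colφ.ne_adj (mem_filter.1 hw').1 (hφ2 x hx w (hNA _ hw) x' (hNA _ hx')
        (h.colφ.ne_adj (mem_filter.1 hw).1) (h.colφ.ne_adj (mem_filter.1 hx').1))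
    have hyy' := h.colφ.ne_adj (mem_filter.1 hy').1
    have hzz' := h.colφ.ne_adj (mem_filter.1 hz').1
    have hyy'θ := h.colθ.ne_adj (mem_filter.1 hy').1
    have hzz'θ := h.colθ.ne_adj (mem_filter.1 hz').1
    have hconf' : ¬ Compat φ θ y' z' := by
      intro hc
      have h1 : φ y' = φ z' := hφ2 y hyA y' hy'A z' hz'A hyy' (hφ ▸ hzz')
      have h2 : θ y' = θ z := hθ2 y hyA y' hy'A z hzA hyy'θ hθ.symm
      exact hzz'θ ((hc.1 h1).symm.trans h2)
    have hd : #(N y) + #(N z) + #(N y') + #(N z') ≤ #A := by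
      rw [← card_union_of_disjoint (hdisj y z hyz), ← card_union_of_disjoint,
        ← card_union_of_disjoint]
      · exact card_le_card (union_subset (union_subset (union_subset (hNA _) (hNA _)) (hNA _))
          (hNA _))
      · rw [disjoint_union_left, disjoint_union_left]
        exact ⟨⟨hsep y hy z hz hφ hθ (.inr hK) z' hz', hadj z hzA z' hz'⟩, hdisj _ _ hconf'⟩
      · rw [disjoint_union_left]
        exact ⟨hadj y hyA y' hy', hsep z hz y hy hφ.symm hθ.symm (.inr hK) y' hy'⟩
    have hd' : (#(N y) : ℝ) + #(N z) + #(N y') + #(N z') ≤ #A := by exact_mod_cast hd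
    obtain ⟨M, hM, hmax⟩ := exists_max_image {y, z, y', z'} σ (insert_nonempty _ _)
    have hMV : M ∈ nb Δ ∅ := by
      simp only [mem_insert, mem_singleton] at hM
      rcases hM with rfl | rfl | rfl | rfl
      exacts [hy, hz, hAV hy'A, hAV hz'A]
    have hlow : ∀ x ∈ ({y, z, y', z'} : Finset α), x ∈ nb Δ ∅ →
        (3 * (m : ℝ) - 2) * u - (m - 1) * σ M < #(N x) := by
      intro x hx hxV
      have h1 := hσ₃ x hxV
      have h2 := mul_le_mul_of_nonneg_left (hmax x hx) (by linarith : 0 ≤ (m : ℝ) - 1)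
      rw [(by linarith : (i : ℝ) - 1 - #C = -(m - 1))] at h1
      linarith
    have l1 := hlow y (by simp) hy
    have l2 := hlow z (by simp) hz
    have l3 := hlow y' (by simp) (hAV hy'A)
    have l4 := hlow z' (by simp) (hAV hz'A)
    have l5 := hσ₄ M hMV
    have l6 : 4 * ((3 * (m : ℝ) - 2) * u) + (i - 1 - 3 * (m - 1)) * σ M <
        #{w ∈ nb Δ ∅ | φ w ∈ C} + #A := by
      simp only [mem_insert, mem_singleton] at hM
      rcases hM with rfl | rfl | rfl | rfl <;> linarith
    have l7 := mul_le_mul_of_nonpos_left (hσ₂ M hMV)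
      (by linarith : (i : ℝ) - 1 - 3 * (m - 1) ≤ 0)
    rw [hkR] at hsize
    linarith
  · have hKR : (#C : ℝ) + 3 = k := by exact_mod_cast hK
    have key : ∀ y ∈ nb Δ ∅, ∀ z ∈ nb Δ ∅, φ y = φ z → θ y ≠ θ z → σ z ≤ σ y → False := by
      intro y hy z hz hφ hθ hyz
      have hconf : ¬ Compat φ θ y z := fun h' => hθ (h'.1 hφ)
      have hzA := hconfA z hz y hy hφ.symm hθ.symm
      have hC1 : (i : ℝ) - 1 - #C = -(m - 2) := by linarith
      have hz1 := hσ₃ z hz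
      rw [hC1] at hz1
      have hpos : (N z).Nonempty := by
        rw [← card_pos]
        have h2 : (0 : ℝ) < #(N z) := by
          nlinarith [mul_le_mul_of_nonneg_left (hσ₂ z hz) (by linarith : 0 ≤ (m : ℝ) - 2)]
        exact_mod_cast h2
      obtain ⟨z', hz', hmax⟩ := exists_max_image (N z) (fun v => #{w ∈ N z | φ w = φ v}) hpos
      have hz'A := hNA _ hz'
      set R := {w ∈ N z | φ w = φ z'} with hR
      have hRc : (#(N z) : ℝ) ≤ 2 * #R := by
        have h1 : #((N z).image φ) ≤ 2 := by
          have h2 : (N z).image φ ⊆ (A.image φ).erase (φ z) := by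
            intro c hc
            obtain ⟨w, hw, rfl⟩ := mem_image.1 hc
            exact mem_erase.2 ⟨h.colφ.ne_adj (mem_filter.1 hw).1, mem_image_of_mem _ (hNA _ hw)⟩
          have h3 := card_le_card h2
          rw [card_erase_of_mem (mem_image_of_mem _ hzA)] at h3
          omega
        refine (card_le_of_classes (φ := φ) (fun w hw => mem_image_of_mem _ hw)
          (t := #R) ?_).trans ?_
        · intro c hc
          obtain ⟨w, hw, rfl⟩ := mem_image.1 hc
          exact_mod_cast hmax w hw
        · gcongr
          exact_mod_cast h1
      have hd : #(N y) + #(N z') + #R ≤ #A := by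
        rw [← card_union_of_disjoint (hsep y hy z hz hφ hθ (.inl hK) z' hz'),
          ← card_union_of_disjoint]
        · exact card_le_card (union_subset (union_subset (hNA _) (hNA _))
            ((filter_subset _ _).trans (hNA _)))
        · rw [disjoint_union_left]
          refine ⟨(hdisj y z hconf).mono_right (filter_subset _ _), ?_⟩
          rw [disjoint_left]
          intro w hw hwR
          exact h.colφ.ne_adj (mem_filter.1 hw).1 (mem_filter.1 hwR).2
      have hd' : (#(N y) : ℝ) + #(N z') + #R ≤ #A := by exact_mod_cast hd
      have hy1 := hσ₃ y hy
      have hz'1 := hσ₃ z' (hAV hz'A)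
      rw [hC1] at hy1 hz'1
      have hy2 := hσ₄ y hy
      have hz'2 := hσ₄ z' (hAV hz'A)
      have hfin : ∀ s : ℝ, (3 * (m : ℝ) - 2) * u ≤ m * s → s ≤ 3 * u →
          (3 * (k : ℝ) - 2) * u ≤ 5 / 2 * ((3 * (m : ℝ) - 2) * u) + (i + 2 - 3 / 2 * m) * s := by
        intro s h1 h2
        refine interpolate (by linarith : (0 : ℝ) < m) h1 h2 ?_ ?_
        · rw [hkR]; nlinarith [mul_nonneg (sub_nonneg.2 hmR) hu.le]
        · rw [hkR]; nlinarith
      have hm20 : 0 ≤ (m : ℝ) - 2 := by linarith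
      have l1 := mul_le_mul_of_nonneg_left hyz hm20
      rcases le_total (σ z') (σ y) with hle | hle
      · have l2 := mul_le_mul_of_nonneg_left hle hm20
        have l3 := hfin _ (hσ₁ y hy) (hσ₂ y hy)
        linarith
      · have l2 := mul_le_mul_of_nonneg_left hle hm20
        have l3 := hfin _ (hσ₁ z' (hAV hz'A)) (hσ₂ z' (hAV hz'A))
        linarith
    rcases le_total (σ z) (σ y) with h' | h'
    · exact key y hy z hz hφ hθ h'
    · exact key z hz y hy hφ.symm hθ.symm h'
  · have h1 : #(N y) + #(N z) ≤ #A := by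
      rw [← card_union_of_disjoint (hdisj y z hyz)]
      exact card_le_card (union_subset (hNA y) (hNA z))
    have h2 : (#(N y) : ℝ) + #(N z) ≤ #A := by exact_mod_cast h1
    have hKR : (#C : ℝ) + 4 ≤ k := by exact_mod_cast hK
    have key : ∀ y ∈ nb Δ ∅, ∀ z ∈ nb Δ ∅, (#(N y) : ℝ) + #(N z) ≤ #A → σ z ≤ σ y → False := by
      intro y hy z hz h2 hyz
      have h3 := hσ₄ y hy
      have h4 := hσ₃ z hz
      have h5 := hσ₁ y hy
      have h6 := hσ₁ z hz
      have h7 := hσ0 z hz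
      have h8 := hσ₂ y hy
      rcases hm2.eq_or_lt with rfl | hm3
      · push_cast at *
        nlinarith [mul_nonneg h7 (by linarith : 0 ≤ (i : ℝ) - 1 - #C - 1)]
      · have hm3R : (3 : ℝ) ≤ m := by exact_mod_cast hm3
        have h9 := mul_nonneg h7 (by linarith : 0 ≤ (i : ℝ) - 1 - #C - (3 - m))
        have h10 := mul_nonneg (sub_nonneg.2 hyz) (by linarith : 0 ≤ (m : ℝ) - 3)
        have h11 := interpolate (R := (3 * (k : ℝ) - 2) * u) (c := 2) (a := i + 2 - m)
          (by linarith : (0 : ℝ) < m) h5 h8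
          (by rw [hkR]; nlinarith [mul_nonneg (sub_nonneg.2 hmR) hu.le])
          (by rw [hkR]; nlinarith)
        nlinarith
    rcases le_total (σ z) (σ y) with h' | h'
    · exact key y hy z hz h2 h'
    · exact key z hz y hy (by linarith) h'

theorem noConf (h : Lvl Δ i m k u φ θ) : NoConf φ θ (nb Δ ∅) := fun _ hy _ hz =>
  ⟨fun hφ => by_contra fun hθ => h.false_of_conf hy hz hφ hθ,
    fun hθ => by_contra fun hφ => h.swap.false_of_conf hy hz hθ hφ⟩

end Lvl

end UniqueColoring

namespace UniqueColoring

open Finset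

variable {α γ : Type*} [Fintype α] [DecidableEq α] [DecidableEq γ]

theorem noConf_of_le_three_mul {m : ℕ} {u : ℝ} (hu : 0 < u) {φ θ : α → γ} {i : ℕ} (hi : 1 ≤ i)
    (him : i + 2 ≤ 3 * m) {Δ : Finset (Finset α)} (h : IsCx Δ i ((3 * (m : ℝ) - 2) * u))
    (hφ : Colored Δ (m + i) φ) (hθ : Colored Δ (m + i) θ)
    (hV : (#(nb Δ ∅) : ℝ) ≤ (3 * ((m : ℝ) + i) - 2) * u) : NoConf φ θ (nb Δ ∅) := by
  induction i, hi using Nat.le_induction generalizing Δ with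
  | base =>
    refine Lvl.noConf (i := 1) (m := m) (k := m + 1) (u := u)
      ⟨h, hφ, hθ, hu, rfl, le_rfl, him, by push_cast at *; linarith, fun x hx => .inl ⟨hx, ?_⟩⟩
    have := h.deg {x} (mem_vert.1 hx) (by simp)
    push_cast
    linarith
  | succ i hi ih =>
    refine Lvl.noConf (i := i + 1) (m := m) (k := m + (i + 1)) (u := u)
      ⟨h, hφ, hθ, hu, rfl, by omega, him, by push_cast at *; linarith, fun x hx => ?_⟩
    rcases lt_or_ge ((3 * ((m + (i + 1) : ℕ) : ℝ) - 5) * u) (#(nb Δ {x}) : ℝ) with hx' | hx'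
    · exact .inl ⟨hx, hx'⟩
    · refine .inr ⟨by omega, ?_⟩
      rw [← vert_lk]
      refine ih (by omega) (h.link hx) (hφ.link h hx) (hθ.link h hx) ?_
      rw [vert_lk]
      push_cast at *
      linarith

section Descent

variable {m i : ℕ} {d : ℝ} {φ θ : α → γ} {Δ : Finset (Finset α)} {y z : α}

theorem IsCx.lt_card_nb {D : ℝ} (h : IsCx Δ i D) (hD : D = m * d) (hm : 1 ≤ m)
    (hφ : Colored Δ (m + i) φ) (hi : 2 ≤ i) (hy : y ∈ nb Δ ∅) :
    (m + i - 1) * d < #(nb Δ {y}) ∧ ∃ T : Finset γ, #T + 1 = i ∧ φ y ∉ T ∧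
      ∀ c ∈ T, d < (#{w ∈ nb Δ {y} | φ w = c} : ℝ) := by
  subst hD
  have hm' : (0 : ℝ) < m := by exact_mod_cast hm
  obtain ⟨σ, h1, h2, h3, T, hT, hyT, hTc⟩ := exists_pivot h hφ hi hy le_rfl ∅ (by simp)
  have h4 : σ = d := le_antisymm h2 (le_of_mul_le_mul_left h1 hm')
  have h5 := h3 ∅ Subset.rfl
  subst h4
  simp only [card_empty, Nat.cast_zero, sub_zero, notMem_empty, not_false_eq_true,
      filter_true] at h5
  exact ⟨by linarith, T, hT, hyT, fun c hc => lt_of_mul_lt_mul_left (hTc c hc) hm'.le⟩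

theorem false_of_conf_of_links (hm : 1 ≤ m) (hd : 0 < d) (hi2 : 2 ≤ i) (hmi : 3 * m ≤ i + 1)
    (h : IsCx Δ i (m * d)) (hφ : Colored Δ (m + i) φ)
    (hV : (#(nb Δ ∅) : ℝ) ≤ ((m : ℝ) + i + 2) * d)
    (hlink : ∀ x ∈ nb Δ ∅, (#(nb Δ {x}) : ℝ) ≤ (m + i + 1) * d → NoConf φ θ (nb Δ {x}))
    (hy : y ∈ nb Δ ∅) (hz : z ∈ nb Δ ∅) (hyz : φ y = φ z) (hθ : θ y ≠ θ z) : False := by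
  obtain ⟨hNy, T, hTc, hyT, hT⟩ := h.lt_card_nb rfl hm hφ hi2 hy
  have hNz := (h.lt_card_nb rfl hm hφ hi2 hz).1
  set X := nb Δ {y} ∩ nb Δ {z} with hX
  have hsmall : ∀ x ∈ X, ∀ S ⊆ nb Δ ∅, (#{v ∈ S | φ v = φ x} : ℝ) < d := by
    intro x hx S hS
    obtain ⟨hxy, hxz⟩ := mem_inter.1 hx
    have h1 : (m + i + 1) * d < #(nb Δ {x}) := by
      by_contra hcon
      exact hθ ((hlink x (h.sub_vert hxy) (not_lt.1 hcon) y (mem_nb_comm.1 hxy) z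
        (mem_nb_comm.1 hxz)).1 hyz)
    have h2 : Disjoint {v ∈ S | φ v = φ x} (nb Δ {x}) := by
      rw [disjoint_left]
      exact fun v hv hvx => hφ.ne_adj hvx (mem_filter.1 hv).2
    have h3 := card_le_card (union_subset ((filter_subset _ _).trans hS) h.sub_vert :
      {v ∈ S | φ v = φ x} ∪ nb Δ {x} ⊆ nb Δ ∅)
    rw [card_union_of_disjoint h2] at h3
    have h4 : (#{v ∈ S | φ v = φ x} : ℝ) + #(nb Δ {x}) ≤ #(nb Δ ∅) := by exact_mod_cast h3
    linarith
  have hcard := card_union_add_card_inter (nb Δ {y}) (nb Δ {z})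
  rw [← hX] at hcard
  have hyzV : nb Δ {y} ∪ nb Δ {z} ⊆ nb Δ ∅ := union_subset h.sub_vert h.sub_vert
  have hcard' : (#(nb Δ {y} ∪ nb Δ {z}) : ℝ) + #X = #(nb Δ {y}) + #(nb Δ {z}) := by
    exact_mod_cast hcard
  rcases hm.eq_or_lt with rfl | hm2
  · have hbig : ∀ x ∈ nb Δ ∅, d < #{v ∈ nb Δ ∅ | φ v = φ x} := by
      intro x hx
      obtain ⟨E, hE, hxE, hEc⟩ := h.exists_ext (mem_vert.1 hx) (j := i + 1) (by simp) le_rfl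
      rw [singleton_subset_iff] at hxE
      have heΔ := h.down E hE _ (erase_subset x E)
      have hec : #(E.erase x) = i := by rw [card_erase_of_mem hxE, hEc]; rfl
      have h1 := h.deg _ heΔ hec
      have h2 := hφ.card_nb h heΔ
      have hxe : x ∈ nb Δ (E.erase x) := mem_nb.2 ⟨by simp, by rwa [insert_erase hxE]⟩
      have h3 : nb Δ (E.erase x) ⊆ {v ∈ nb Δ ∅ | φ v = φ x} := fun v hv =>
        mem_filter.2 ⟨h.sub_vert hv, card_le_one.1 (by omega) _ (mem_image_of_mem _ hv) _
          (mem_image_of_mem _ hxe)⟩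
      have h4 : (#(nb Δ (E.erase x)) : ℝ) ≤ #{v ∈ nb Δ ∅ | φ v = φ x} := by
        exact_mod_cast card_le_card h3
      push_cast at h1
      linarith
    have hX0 : X = ∅ := by
      by_contra hne
      obtain ⟨x, hx⟩ := nonempty_iff_ne_empty.2 hne
      exact lt_asymm (hbig x (h.sub_vert (mem_inter.1 hx).1)) (hsmall x hx _ Subset.rfl)
    have h1 : Disjoint (nb Δ {y} ∪ nb Δ {z}) {v ∈ nb Δ ∅ | φ v = φ y} := by
      rw [disjoint_left]
      intro v hv hvy
      rcases mem_union.1 hv with hv | hv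
      · exact hφ.ne_adj hv (mem_filter.1 hvy).2
      · exact hφ.ne_adj hv ((mem_filter.1 hvy).2.trans hyz)
    have h2 := card_le_card (union_subset hyzV (filter_subset _ _) :
      nb Δ {y} ∪ nb Δ {z} ∪ {v ∈ nb Δ ∅ | φ v = φ y} ⊆ nb Δ ∅)
    rw [card_union_of_disjoint h1] at h2
    have h3 : (#(nb Δ {y} ∪ nb Δ {z}) : ℝ) + #{v ∈ nb Δ ∅ | φ v = φ y} ≤ #(nb Δ ∅) := by
      exact_mod_cast h2
    have h4 := hbig y hy
    have h5 : (2 : ℝ) ≤ i := by exact_mod_cast hi2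
    rw [hX0] at hcard'
    simp only [card_empty, Nat.cast_zero, Nat.cast_one] at *
    nlinarith
  · have hXm : (#X : ℝ) ≤ m * d := by
      have h1 : X.image φ ⊆ ((nb Δ ∅).image φ).erase (φ y) \ T := by
        intro c hc
        obtain ⟨x, hx, rfl⟩ := mem_image.1 hc
        obtain ⟨hxy, -⟩ := mem_inter.1 hx
        refine mem_sdiff.2 ⟨mem_erase.2 ⟨hφ.ne_adj hxy, mem_image_of_mem _ (h.sub_vert hxy)⟩, ?_⟩
        exact fun hxT => lt_asymm (hT _ hxT) (hsmall x hx _ h.sub_vert)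
      have hTsub : T ⊆ ((nb Δ ∅).image φ).erase (φ y) := by
        intro c hc
        have h2 : (0 : ℝ) < #{w ∈ nb Δ {y} | φ w = c} := hd.trans (hT c hc)
        obtain ⟨w, hw⟩ := card_pos.1 (by exact_mod_cast h2)
        obtain ⟨hwy, rfl⟩ := mem_filter.1 hw
        exact mem_erase.2 ⟨hφ.ne_adj hwy, mem_image_of_mem _ (h.sub_vert hwy)⟩
      have h2 := card_le_card h1
      rw [card_sdiff_of_subset hTsub, card_erase_of_mem (mem_image_of_mem _ hy)] at h2
      have h3 := hφ.card
      have h4 : #(X.image φ) ≤ m := by omega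
      refine (card_le_of_classes (φ := φ) (fun w hw => mem_image_of_mem _ hw) (t := d)
        ?_).trans ?_
      · intro c hc
        obtain ⟨x, hx, rfl⟩ := mem_image.1 hc
        exact (hsmall x hx _ (inter_subset_left.trans h.sub_vert)).le
      · gcongr
    have h1 : (#(nb Δ {y} ∪ nb Δ {z}) : ℝ) ≤ #(nb Δ ∅) := by exact_mod_cast card_le_card hyzV
    have h2 : (4 : ℝ) ≤ i := by exact_mod_cast (by omega : 4 ≤ i)
    nlinarith

theorem noConf_of_three_mul_le (hm : 1 ≤ m) (hd : 0 < d) (hmi : 3 * m - 2 ≤ i)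
    (h : IsCx Δ i (m * d)) (hφ : Colored Δ (m + i) φ) (hθ : Colored Δ (m + i) θ)
    (hV : (#(nb Δ ∅) : ℝ) ≤ ((m : ℝ) + i + 2) * d) : NoConf φ θ (nb Δ ∅) := by
  induction i, hmi using Nat.le_induction generalizing Δ with
  | base =>
    have hm' : (1 : ℝ) ≤ m := by exact_mod_cast hm
    have h0 : (0 : ℝ) < 3 * m - 2 := by linarith
    have hc : ((3 * m - 2 : ℕ) : ℝ) = 3 * m - 2 := by
      rw [Nat.cast_sub (by omega)]; push_cast; ring
    have hu : (3 * (m : ℝ) - 2) * (m * d / (3 * m - 2)) = m * d := by field_simp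
    refine noConf_of_le_three_mul (m := m) (u := m * d / (3 * m - 2)) (by positivity)
      (i := 3 * m - 2) (by omega) (by omega) (by rwa [hu]) hφ hθ (hV.trans (le_of_eq ?_))
    rw [hc]
    linear_combination (-4 : ℝ) * hu
  | succ i hmi ih =>
    have hlink : ∀ x ∈ nb Δ ∅, (#(nb Δ {x}) : ℝ) ≤ (m + (i + 1 : ℕ) + 1) * d →
        NoConf φ θ (nb Δ {x}) := by
      intro x hx hxd
      rw [← vert_lk]
      refine ih (h.link hx) (hφ.link h hx) (hθ.link h hx) ?_
      rw [vert_lk]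
      push_cast at hxd
      linarith
    have hlink' : ∀ x ∈ nb Δ ∅, (#(nb Δ {x}) : ℝ) ≤ (m + (i + 1 : ℕ) + 1) * d →
        NoConf θ φ (nb Δ {x}) := fun x hx hxd => (hlink x hx hxd).swap
    exact fun y hy z hz =>
      ⟨fun h1 => by_contra fun h2 => false_of_conf_of_links hm hd (by omega) (by omega) h hφ hV
        hlink hy hz h1 h2,
      fun h1 => by_contra fun h2 => false_of_conf_of_links hm hd (by omega) (by omega) h hθ hV
        hlink' hy hz h1 h2⟩

end Descent

end UniqueColoring

namespace UniqueColoring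

open Finset

section Maclaurin

variable {γ : Type*} [DecidableEq γ] (a : γ → ℝ)

theorem sum_powersetCard_erase_mul (s : ℕ) (C : Finset γ) :
    ∑ c ∈ C, a c * ∑ T ∈ powersetCard s (C.erase c), ∏ x ∈ T, a x =
      (s + 1) * ∑ T ∈ powersetCard (s + 1) C, ∏ x ∈ T, a x := by
  have h1 : ∀ T ∈ powersetCard (s + 1) C, ((s : ℝ) + 1) * ∏ x ∈ T, a x =
      ∑ _c ∈ T, ∏ x ∈ T, a x := by
    intro T hT
    rw [sum_const, (mem_powersetCard.1 hT).2, nsmul_eq_mul]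
    push_cast; ring
  simp_rw [mul_sum]
  rw [sum_congr rfl h1, sum_sigma', sum_sigma']
  refine sum_bij' (fun p _ => ⟨insert p.1 p.2, p.1⟩) (fun p _ => ⟨p.2, p.1.erase p.2⟩)
    ?_ ?_ ?_ ?_ ?_
  · rintro ⟨c, T⟩ hp
    simp only [mem_sigma, mem_powersetCard] at hp ⊢
    obtain ⟨hc, hT, hTc⟩ := hp
    have hcT : c ∉ T := fun h => notMem_erase c C (hT h)
    exact ⟨⟨insert_subset hc (hT.trans (erase_subset _ _)), by
      rw [card_insert_of_notMem hcT, hTc]⟩, mem_insert_self _ _⟩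
  · rintro ⟨T, c⟩ hp
    simp only [mem_sigma, mem_powersetCard] at hp ⊢
    obtain ⟨⟨hT, hTc⟩, hc⟩ := hp
    exact ⟨hT hc, erase_subset_erase _ hT, by rw [card_erase_of_mem hc, hTc]; rfl⟩
  · rintro ⟨c, T⟩ hp
    simp only [mem_sigma, mem_powersetCard] at hp
    have hcT : c ∉ T := fun h => notMem_erase c C (hp.2.1 h)
    simp [erase_insert hcT]
  · rintro ⟨T, c⟩ hp
    simp only [mem_sigma, mem_powersetCard] at hp
    simp [insert_erase hp.2]
  · rintro ⟨c, T⟩ hp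
    simp only [mem_sigma, mem_powersetCard] at hp
    have hcT : c ∉ T := fun h => notMem_erase c C (hp.2.1 h)
    simp [prod_insert hcT]

theorem sum_powersetCard_erase (s : ℕ) (C : Finset γ) :
    ∑ c ∈ C, ∑ T ∈ powersetCard s (C.erase c), ∏ x ∈ T, a x =
      ((#C - s : ℕ) : ℝ) * ∑ T ∈ powersetCard s C, ∏ x ∈ T, a x := by
  rw [mul_sum, sum_comm' (t' := powersetCard s C) (s' := fun T => C \ T)]
  · refine sum_congr rfl fun T hT => ?_
    obtain ⟨hT, hTc⟩ := mem_powersetCard.1 hT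
    rw [sum_const, card_sdiff_of_subset hT, hTc, nsmul_eq_mul]
  · intro c T
    simp only [mem_powersetCard, mem_sdiff, subset_erase]
    tauto

variable {a}

theorem antivaryOn_sum_powersetCard_erase (ha : ∀ c, 0 ≤ a c) (s : ℕ) (C : Finset γ) :
    AntivaryOn a (fun c => ∑ T ∈ powersetCard s (C.erase c), ∏ x ∈ T, a x) C := by
  intro c hc c' hc' hlt
  by_contra hcon
  push Not at hcon
  refine hlt.not_ge ?_
  have hne : c ≠ c' := by rintro rfl; exact lt_irrefl _ hcon
  have h1 : C.erase c = insert c' ((C.erase c).erase c') :=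
    (insert_erase (mem_erase.2 ⟨hne.symm, hc'⟩)).symm
  have h2 : C.erase c' = insert c ((C.erase c).erase c') := by
    rw [erase_right_comm, insert_erase (mem_erase.2 ⟨hne, hc⟩)]
  have h3 : ∀ b, b ∉ (C.erase c).erase c' → ∀ s,
      ∑ T ∈ powersetCard (s + 1) (insert b ((C.erase c).erase c')), ∏ x ∈ T, a x =
      ∑ T ∈ powersetCard (s + 1) ((C.erase c).erase c'), ∏ x ∈ T, a x +
        a b * ∑ T ∈ powersetCard s ((C.erase c).erase c'), ∏ x ∈ T, a x := by
    intro b hb s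
    rw [powersetCard_succ_insert hb, sum_union, sum_image, mul_sum]
    · congr 1
      refine sum_congr rfl fun T hT => prod_insert fun h => hb ((mem_powersetCard.1 hT).1 h)
    · intro T hT T' hT' h
      have hbT : b ∉ T := fun h => hb ((mem_powersetCard.1 hT).1 h)
      have hbT' : b ∉ T' := fun h => hb ((mem_powersetCard.1 hT').1 h)
      rw [← erase_insert hbT, ← erase_insert hbT', h]
    · rw [disjoint_left]
      intro T hT hT'
      obtain ⟨T', -, rfl⟩ := mem_image.1 hT'
      exact hb ((mem_powersetCard.1 hT).1 (mem_insert_self _ _))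
  rcases s with _ | s
  · simp
  · dsimp only
    rw [h1, h2, h3 c' (by simp), h3 c (by simp)]
    gcongr
    exact sum_nonneg fun T _ => prod_nonneg fun x _ => ha x

/-- Maclaurin's inequality between an elementary symmetric mean and the arithmetic mean. -/
theorem sum_powersetCard_mul_pow_le (ha : ∀ c, 0 ≤ a c) (s : ℕ) (C : Finset γ) :
    (∑ T ∈ powersetCard s C, ∏ x ∈ T, a x) * (#C : ℝ) ^ s ≤
      (#C).choose s * (∑ c ∈ C, a c) ^ s := by
  induction s with
  | zero => simp
  | succ s ih =>
    have h1 := (antivaryOn_sum_powersetCard_erase ha s C).card_mul_sum_le_sum_mul_sum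
    rw [sum_powersetCard_erase_mul, sum_powersetCard_erase] at h1
    have h2 : ((#C).choose (s + 1) : ℝ) * (s + 1) = (#C).choose s * (#C - s : ℕ) := by
      exact_mod_cast Nat.choose_succ_right_eq #C s
    have hA : 0 ≤ ∑ c ∈ C, a c := sum_nonneg fun c _ => ha c
    have hs : (0 : ℝ) < s + 1 := by positivity
    refine le_of_mul_le_mul_left ?_ hs
    calc ((s : ℝ) + 1) * ((∑ T ∈ powersetCard (s + 1) C, ∏ x ∈ T, a x) * (#C : ℝ) ^ (s + 1))
        = (#C * ((s + 1) * ∑ T ∈ powersetCard (s + 1) C, ∏ x ∈ T, a x)) * (#C : ℝ) ^ s := by ring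
      _ ≤ ((∑ c ∈ C, a c) * ((#C - s : ℕ) * ∑ T ∈ powersetCard s C, ∏ x ∈ T, a x)) *
          (#C : ℝ) ^ s := by gcongr
      _ = (∑ c ∈ C, a c) * (#C - s : ℕ) *
          ((∑ T ∈ powersetCard s C, ∏ x ∈ T, a x) * (#C : ℝ) ^ s) := by ring
      _ ≤ (∑ c ∈ C, a c) * (#C - s : ℕ) * ((#C).choose s * (∑ c ∈ C, a c) ^ s) := by gcongr
      _ = (s + 1) * ((#C).choose (s + 1) * (∑ c ∈ C, a c) ^ (s + 1)) := by
        linear_combination (-(∑ c ∈ C, a c) ^ (s + 1)) * h2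

end Maclaurin

/-- The number of rainbow `s`-subsets of `N` with colours in `C`. -/
theorem card_rainbow_le {α γ : Type*} [DecidableEq α] [DecidableEq γ] {φ : α → γ}
    {N : Finset α} {C : Finset γ} {s : ℕ} {P : Finset (Finset α)}
    (hP : ∀ f ∈ P, f ⊆ N ∧ #f = s ∧ f.image φ ⊆ C ∧ Set.InjOn φ f) :
    #P ≤ ∑ T ∈ powersetCard s C, ∏ c ∈ T, #{v ∈ N | φ v = c} := by
  rw [card_eq_sum_card_fiberwise (f := fun f => f.image φ) (t := powersetCard s C)]
  · refine sum_le_sum fun T _ => ?_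
    rw [← card_pi]
    refine (card_le_card (t := (T.pi fun c => {v ∈ N | φ v = c}).image
      fun g => T.attach.image fun c => g c.1 c.2) ?_).trans card_image_le
    intro f hf
    obtain ⟨hfP, rfl⟩ := mem_filter.1 hf
    obtain ⟨hfN, -, -, -⟩ := hP f hfP
    have hex : ∀ c ∈ f.image φ, ∃ v ∈ f, φ v = c := fun c hc => mem_image.1 hc
    choose g hg1 hg2 using hex
    refine mem_image.2 ⟨g, mem_pi.2 fun c hc => mem_filter.2 ⟨hfN (hg1 c hc), hg2 c hc⟩, ?_⟩
    ext v
    simp only [mem_image, mem_attach, true_and, Subtype.exists]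
    constructor
    · rintro ⟨c, hc, rfl⟩
      exact hg1 c (mem_image.2 hc)
    · intro hv
      exact ⟨φ v, ⟨v, hv, rfl⟩, (hP f hfP).2.2.2 (hg1 _ (mem_image_of_mem _ hv)) hv (hg2 _ _)⟩
  · intro f hf
    obtain ⟨-, h2, h3, h4⟩ := hP f hf
    exact mem_powersetCard.2 ⟨h3, by rw [card_image_of_injOn h4, h2]⟩

theorem exists_perm_comp_eq {α γ : Type*} [Nonempty α] [Fintype γ] [DecidableEq γ] {φ θ : α → γ}
    (h : ∀ u v, φ u = φ v ↔ θ u = θ v) : ∃ η : Equiv.Perm γ, η ∘ φ = θ := by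
  classical
  have hinv : ∀ v, φ (Function.invFun φ (φ v)) = φ v := fun v => Function.invFun_eq ⟨v, rfl⟩
  obtain ⟨g, hg⟩ := Set.MapsTo.exists_equiv_extend_of_card_eq (t := (univ : Finset γ))
    (s := Set.range φ) (f := θ ∘ Function.invFun φ) (by simp) (by simp [Set.MapsTo]) (by
      rintro _ ⟨u, rfl⟩ _ ⟨v, rfl⟩ huv
      have := (h _ _).2 huv
      rwa [hinv, hinv] at this)
  refine ⟨g.trans (Equiv.subtypeUnivEquiv fun x => mem_univ x), funext fun v => ?_⟩
  exact (hg (φ v) ⟨v, rfl⟩).trans ((h _ _).1 (hinv v))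

end UniqueColoring

namespace UniqueColoring

open Finset

/-- A face of size `i` with more than `C(m, s) d ^ s` rainbow extensions of size `s` avoiding
its own colours has more than `m d` extensions of size one. -/
theorem lt_card_nb {α γ : Type*} [Fintype α] [DecidableEq α] [Fintype γ] [DecidableEq γ]
    {φ : α → γ} {Δ P : Finset (Finset α)} {e : Finset α} {m s : ℕ} {d : ℝ}
    (hm : 1 ≤ m) (he : Set.InjOn φ (e : Set α)) (hcard : #e + m = Fintype.card γ)
    (hP : ∀ f ∈ P, f ⊆ nb Δ e ∧ #f = s ∧ Disjoint e f ∧ Set.InjOn φ ((e ∪ f : Finset α) : Set α))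
    (hlt : (m.choose s : ℝ) * d ^ s < #P) : m * d < #(nb Δ e) := by
  set N := nb Δ e
  set C := univ \ e.image φ
  have hC : #C = m := by
    rw [card_univ_sdiff, card_image_of_injOn he]
    omega
  have h1 : #P ≤ ∑ T ∈ powersetCard s C, ∏ c ∈ T, #{v ∈ N | φ v = c} := by
    refine card_rainbow_le fun f hf => ?_
    obtain ⟨hfN, hfs, hd, hinj⟩ := hP f hf
    refine ⟨hfN, hfs, ?_, hinj.mono (by simp)⟩
    intro c hc
    obtain ⟨v, hv, rfl⟩ := mem_image.1 hc
    refine mem_sdiff.2 ⟨mem_univ _, fun h => ?_⟩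
    obtain ⟨w, hw, hwv⟩ := mem_image.1 h
    have := hinj (mem_coe.2 (mem_union_left _ hw)) (mem_coe.2 (mem_union_right _ hv)) hwv
    exact disjoint_left.1 hd hw (this ▸ hv)
  have h1' : (#P : ℝ) ≤ ∑ T ∈ powersetCard s C, ∏ c ∈ T, (#{v ∈ N | φ v = c} : ℝ) := by
    exact_mod_cast h1
  have h2 := sum_powersetCard_mul_pow_le (a := fun c => (#{v ∈ N | φ v = c} : ℝ))
    (fun c => Nat.cast_nonneg _) s C
  have h3 : ∑ c ∈ C, (#{v ∈ N | φ v = c} : ℝ) ≤ #N := by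
    have : ∑ c ∈ C, #{v ∈ N | φ v = c} ≤ #N := by
      rw [← card_biUnion]
      · exact card_le_card (biUnion_subset.2 fun c _ => filter_subset _ _)
      · intro a _ b _ hab
        rw [Function.onFun, disjoint_left]
        intro v hv hv'
        exact hab ((mem_filter.1 hv).2.symm.trans (mem_filter.1 hv').2)
    exact_mod_cast this
  have h0 : 0 ≤ ∑ c ∈ C, (#{v ∈ N | φ v = c} : ℝ) := sum_nonneg fun c _ => Nat.cast_nonneg _
  rw [hC] at h2
  have hm0 : (0 : ℝ) < m := by exact_mod_cast hm
  have h4 : (m.choose s : ℝ) * (m * d) ^ s < m.choose s * (#N : ℝ) ^ s := by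
    calc (m.choose s : ℝ) * (m * d) ^ s = m.choose s * d ^ s * (m : ℝ) ^ s := by
          rw [mul_pow]; ring
      _ < #P * (m : ℝ) ^ s := mul_lt_mul_of_pos_right hlt (pow_pos hm0 s)
      _ ≤ _ := mul_le_mul_of_nonneg_right h1' (pow_pos hm0 s).le
      _ ≤ _ := h2
      _ ≤ m.choose s * (#N : ℝ) ^ s :=
          mul_le_mul_of_nonneg_left (pow_le_pow_left₀ h0 h3 s) (Nat.cast_nonneg _)
  exact lt_of_pow_lt_pow_left₀ s (Nat.cast_nonneg _)
    (lt_of_mul_lt_mul_left h4 (Nat.cast_nonneg _))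

/-- The faces of size at most `j` of the simplicial complex generated by `H`. -/
def skeleton {α : Type*} [Fintype α] [DecidableEq α] (H : Finset (Finset α)) (j : ℕ) :
    Finset (Finset α) :=
  univ.filter fun e => #e ≤ j ∧ ∃ E ∈ H, e ⊆ E

/-- The upper bound: large minimum positive degree forces a unique colouring. -/
theorem exists_perm_of_lt_degree {α γ : Type*} [Fintype α] [DecidableEq α] [Nonempty α]
    [Fintype γ] [DecidableEq γ] {H : Finset (Finset α)} {r i m : ℕ} {d : ℝ} {φ θ : α → γ}
    (hi : 1 ≤ i) (hir : i < r) (hm : 1 ≤ m) (hmi : 3 * m - 2 ≤ i)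
    (hcard : i + m = Fintype.card γ) (hd : (Fintype.card α : ℝ) = (m + i + 2) * d)
    (hH : ∀ E ∈ H, #E = r) (hcov : ∀ x, ∃ E ∈ H, x ∈ E)
    (hdeg : ∀ e : Finset α, #e = i → (∃ E ∈ H, e ⊆ E) → (m.choose (r - i) : ℝ) * d ^ (r - i) <
      #{f : Finset α | #f = r - i ∧ Disjoint e f ∧ e ∪ f ∈ H})
    (hφ : ∀ E ∈ H, Set.InjOn φ (E : Set α)) (hθ : ∀ E ∈ H, Set.InjOn θ (E : Set α)) :
    ∃ η : Equiv.Perm γ, η ∘ φ = θ := by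
  have hd0 : 0 < d := by
    have h1 : (0 : ℝ) < (m + i + 2) * d := by rw [← hd]; exact_mod_cast Fintype.card_pos
    exact pos_of_mul_pos_right h1 (by positivity)
  have hmem : ∀ e, e ∈ skeleton H (i + 1) ↔ #e ≤ i + 1 ∧ ∃ E ∈ H, e ⊆ E := by
    simp [skeleton]
  have hvert : nb (skeleton H (i + 1)) ∅ = univ := by
    refine eq_univ_of_forall fun x => ?_
    obtain ⟨E, hE, hx⟩ := hcov x
    rw [mem_vert, hmem]
    exact ⟨by simp, E, hE, by simpa using hx⟩
  have hinj : ∀ ψ : α → γ, (∀ E ∈ H, Set.InjOn ψ (E : Set α)) →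
      Colored (skeleton H (i + 1)) (m + i) ψ := by
    refine fun ψ hψ => ⟨fun e he => ?_, ?_⟩
    · obtain ⟨-, E, hE, heE⟩ := (hmem e).1 he
      exact (hψ E hE).mono (by exact_mod_cast heE)
    · rw [add_comm m i, hcard]
      exact card_le_univ _
  have hcx : IsCx (skeleton H (i + 1)) i (m * d) := by
    refine ⟨fun e he f hf => ?_, ?_, fun e he hei => ?_, fun e he hei => ?_, by positivity⟩
    · obtain ⟨h1, E, hE, heE⟩ := (hmem e).1 he
      exact (hmem f).2 ⟨(card_le_card hf).trans h1, E, hE, hf.trans heE⟩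
    · obtain ⟨E, hE, -⟩ := hcov (Classical.arbitrary α)
      exact (hmem ∅).2 ⟨by simp, E, hE, empty_subset E⟩
    · obtain ⟨-, E, hE, heE⟩ := (hmem e).1 he
      obtain ⟨v, hvE, hve⟩ := exists_mem_notMem_of_card_lt_card
        (show #e < #E by rw [hH E hE]; omega)
      refine ⟨v, mem_nb.2 ⟨hve, (hmem _).2 ⟨?_, E, hE, insert_subset hvE heE⟩⟩⟩
      rw [card_insert_of_notMem hve]; omega
    · obtain ⟨-, E, hE, heE⟩ := (hmem e).1 he
      refine lt_card_nb (φ := φ) hm ((hφ E hE).mono (by exact_mod_cast heE))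
        (by omega) (fun f hf => ?_) (hdeg e hei ⟨E, hE, heE⟩)
      obtain ⟨hfs, hdis, hef⟩ := (mem_filter.1 hf).2
      refine ⟨fun v hv => ?_, hfs, hdis, hφ _ hef⟩
      have hve : v ∉ e := disjoint_right.1 hdis hv
      refine mem_nb.2 ⟨hve, (hmem _).2 ⟨by rw [card_insert_of_notMem hve, hei], _, hef, ?_⟩⟩
      exact insert_subset (mem_union_right _ hv) subset_union_left
  have := noConf_of_three_mul_le hm hd0 hmi hcx (hinj φ hφ) (hinj θ hθ)
    (by rw [hvert, card_univ, hd])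
  rw [hvert] at this
  exact exists_perm_comp_eq fun u v => this u (mem_univ u) v (mem_univ v)

/-- A face of a `k`-set `A` all of whose `r`-subsets are edges has many extensions. -/
theorem choose_le_card_extensions {α : Type*} [Fintype α] [DecidableEq α]
    {H : Finset (Finset α)} {A e : Finset α} {k r : ℕ} (hA : #A = k)
    (hAH : powersetCard r A ⊆ H) (heA : e ⊆ A) (her : #e ≤ r) :
    (k - #e).choose (r - #e) ≤ #{f : Finset α | #f = r - #e ∧ Disjoint e f ∧ e ∪ f ∈ H} := by
  rw [← hA, ← card_sdiff_of_subset heA, ← card_powersetCard]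
  refine card_le_card fun f hf => ?_
  obtain ⟨hfA, hfc⟩ := mem_powersetCard.1 hf
  have hdis : Disjoint e f := (disjoint_sdiff (s := e) (t := A)).mono_right hfA
  refine mem_filter.2 ⟨mem_univ _, hfc, hdis, hAH (mem_powersetCard.2 ⟨?_, ?_⟩)⟩
  · exact union_subset heA (hfA.trans sdiff_subset)
  · rw [card_union_of_disjoint hdis]; omega

/-- The lower bound: two complete `r`-graphs on `k` vertices sharing `k - 2` vertices. -/
theorem exists_not_uniquely_colorable {k r i : ℕ} (hi : 1 ≤ i) (hir : i < r) (hrk : r ≤ k) :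
    ∃ H : Finset (Finset (Fin (k + 2))), (∀ E ∈ H, #E = r) ∧ (∀ x, ∃ E ∈ H, x ∈ E) ∧
      (∀ e : Finset (Fin (k + 2)), #e = i → (∃ E ∈ H, e ⊆ E) → (k - i).choose (r - i) ≤
        #{f : Finset (Fin (k + 2)) | #f = r - i ∧ Disjoint e f ∧ e ∪ f ∈ H}) ∧
      ∃ φ θ : Fin (k + 2) → Fin k, (∀ E ∈ H, Set.InjOn φ (E : Set (Fin (k + 2)))) ∧
        (∀ E ∈ H, Set.InjOn θ (E : Set (Fin (k + 2)))) ∧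
        ∀ η : Equiv.Perm (Fin k), η ∘ φ ≠ θ := by
  let A : Finset (Fin (k + 2)) := univ.image fun j : Fin k => ⟨j, by omega⟩
  let B : Finset (Fin (k + 2)) :=
    univ.image fun j : Fin k => ⟨if (j : ℕ) < k - 2 then j else j + 2, by split_ifs <;> omega⟩
  have hA : #A = k := by
    rw [card_image_of_injective, card_univ, Fintype.card_fin]
    intro a b hab
    simpa [Fin.ext_iff] using hab
  have hB : #B = k := by
    rw [card_image_of_injective, card_univ, Fintype.card_fin]
    intro a b hab
    simp only [Fin.ext_iff] at hab ⊢
    split_ifs at hab <;> omega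
  have hmA : ∀ x ∈ A, (x : ℕ) < k := by
    intro x hx
    obtain ⟨j, -, rfl⟩ := mem_image.1 hx
    exact j.2
  have hmB : ∀ x ∈ B, (x : ℕ) < k - 2 ∨ k ≤ x := by
    intro x hx
    obtain ⟨j, -, rfl⟩ := mem_image.1 hx
    dsimp only
    split_ifs <;> omega
  have hE : ∀ E ∈ powersetCard r A ∪ powersetCard r B, #E = r ∧ (E ⊆ A ∨ E ⊆ B) := by
    intro E hE
    rcases mem_union.1 hE with h | h
    · exact ⟨(mem_powersetCard.1 h).2, Or.inl (mem_powersetCard.1 h).1⟩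
    · exact ⟨(mem_powersetCard.1 h).2, Or.inr (mem_powersetCard.1 h).1⟩
  have hcov : ∀ S : Finset (Fin (k + 2)), #S = k → ∀ x ∈ S, ∃ E ∈ powersetCard r S, x ∈ E := by
    intro S hS x hx
    obtain ⟨E, h1, h2, h3⟩ := exists_subsuperset_card_eq (singleton_subset_iff.2 hx)
      (n := r) (by simp; omega) (by omega)
    exact ⟨E, mem_powersetCard.2 ⟨h2, h3⟩, singleton_subset_iff.1 h1⟩
  refine ⟨powersetCard r A ∪ powersetCard r B, fun E h => (hE E h).1, fun x => ?_, ?_,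
    fun x => ⟨if (x : ℕ) < k then x else x - 2, by split_ifs <;> omega⟩,
    fun x => ⟨if (x : ℕ) < k then x else 2 * k - 1 - x, by split_ifs <;> omega⟩, ?_, ?_, ?_⟩
  · by_cases hx : (x : ℕ) < k
    · obtain ⟨E, h1, h2⟩ := hcov A hA x (mem_image.2 ⟨⟨x, hx⟩, mem_univ _, rfl⟩)
      exact ⟨E, mem_union_left _ h1, h2⟩
    · obtain ⟨E, h1, h2⟩ := hcov B hB x (mem_image.2 ⟨⟨x - 2, by omega⟩, mem_univ _, by
        simp only [Fin.ext_iff]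
        split_ifs <;> omega⟩)
      exact ⟨E, mem_union_right _ h1, h2⟩
  · rintro e rfl ⟨E, h, heE⟩
    rcases (hE E h).2 with hEA | hEB
    · exact choose_le_card_extensions hA subset_union_left (heE.trans hEA) hir.le
    · exact choose_le_card_extensions hB subset_union_right (heE.trans hEB) hir.le
  · intro E h x hx y hy hxy
    simp only [Fin.ext_iff] at hxy ⊢
    rcases (hE E h).2 with hEA | hEB
    · have := hmA x (hEA hx); have := hmA y (hEA hy)
      split_ifs at hxy
      omega
    · have := hmB x (hEB hx); have := hmB y (hEB hy)
      split_ifs at hxy <;> omega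
  · intro E h x hx y hy hxy
    simp only [Fin.ext_iff] at hxy ⊢
    rcases (hE E h).2 with hEA | hEB
    · have := hmA x (hEA hx); have := hmA y (hEA hy)
      split_ifs at hxy
      omega
    · have := hmB x (hEB hx); have := hmB y (hEB hy)
      split_ifs at hxy <;> omega
  · intro η hη
    have h1 := congrFun hη ⟨k - 2, by omega⟩
    have h2 := congrFun hη ⟨k, by omega⟩
    have hk : k - 2 < k := by omega
    simp only [Function.comp_apply, lt_irrefl, if_false, hk, if_true] at h1 h2
    rw [h1] at h2
    simp only [Fin.ext_iff] at h2
    omega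

end UniqueColoring

/-- For k ≤ (4i+2)/3, Φ_{k,r,i} = C(k-i,r-i)·(1/(k+2))^{r-i}: this value is a valid
threshold, and is the least such. -/
theorem stmt13 (k r i : ℕ) (hi : 1 ≤ i) (hir : i < r) (hrk : r ≤ k)
    (hki : 3 * k ≤ 4 * i + 2) :
    isUCThreshold k r i (((k - i).choose (r - i) : ℝ) * (1 / ((k : ℝ) + 2)) ^ (r - i)) ∧
    ∀ c : ℝ, isUCThreshold k r i c →
      ((k - i).choose (r - i) : ℝ) * (1 / ((k : ℝ) + 2)) ^ (r - i) ≤ c := by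
  refine ⟨fun n hkn H hH _ hcov hdeg φ θ hφ hθ => ?_, fun c hc => ?_⟩
  · have : Nonempty (Fin n) := ⟨⟨0, by omega⟩⟩
    have hk2 : (k : ℝ) + 2 ≠ 0 := by positivity
    have hmi : ((k - i : ℕ) : ℝ) + i = k := by exact_mod_cast Nat.sub_add_cancel (by omega)
    refine UniqueColoring.exists_perm_of_lt_degree (m := k - i) (d := 1 / ((k : ℝ) + 2) * n) hi hir
      (by omega) (by omega) (by rw [Fintype.card_fin]; omega) ?_ hH hcov (fun e he heH => ?_) hφ hθ
    · rw [hmi, Fintype.card_fin]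
      field_simp
    · rw [mul_pow, ← mul_assoc]
      exact hdeg e he heH
  · by_contra! hlt
    obtain ⟨H, hH, hcov, hdeg, φ, θ, hφ, hθ, hne⟩ :=
      UniqueColoring.exists_not_uniquely_colorable hi hir hrk
    have hdeg_lt : ∀ e : Finset (Fin (k + 2)), e.card = i → (∃ E ∈ H, e ⊆ E) →
        c * ((k + 2 : ℕ) : ℝ) ^ (r - i) < ((Finset.univ.filter
          fun f => f.card = r - i ∧ Disjoint e f ∧ e ∪ f ∈ H).card : ℝ) := by
      intro e he heH
      have hpow : (0 : ℝ) < ((k + 2 : ℕ) : ℝ) ^ (r - i) := by positivity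
      calc c * ((k + 2 : ℕ) : ℝ) ^ (r - i)
          < ((k - i).choose (r - i) : ℝ) * (1 / ((k : ℝ) + 2)) ^ (r - i) *
            ((k + 2 : ℕ) : ℝ) ^ (r - i) := mul_lt_mul_of_pos_right hlt hpow
        _ = ((k - i).choose (r - i) : ℝ) := by
          have hk2 : (k : ℝ) + 2 ≠ 0 := by positivity
          rw [mul_assoc, ← mul_pow]
          push_cast
          rw [one_div_mul_cancel hk2, one_pow, mul_one]
        _ ≤ _ := by exact_mod_cast hdeg e he heH
    obtain ⟨η, hη⟩ := hc (k + 2) (by omega) H hH ⟨φ, hφ⟩ hcov hdeg_lt φ θ hφ hθ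
    exact hne η hη
end
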